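/- Theorem 2 (inner bound for DSC/delivery). Suppose there exist finite sets 𝒬, 𝒰₁, 𝒰₂, 𝒱₁, 𝒱₂ and random variables Q, U₁, U₂, V₁, V₂ jointly distributed with (X,Y,Z) ~ p whose joint pmf factorizes as p(x,y,z)p(q)p(u₁|x,q)p(u₂|y,q)p(v₁,v₂|u₁,u₂,z,q), together with functions Ψ_A : 𝒳×𝒱₂ → 𝒴̂ and Ψ_B : 𝒴×𝒱₁ → 𝒳̂ satisfying E[d_A(Y, Ψ_A(X,V₂))] ≤ D_A and E[d_B(X, Ψ_B(Y,V₁))] ≤ D_B. Then any rate vector (R_AR, R_BR, R_RA, R_RB) satisfying R_AR ≥ I(X;U₁|Z,U₂,Q), R_BR ≥ I(Y;U₂|Z,U₁,Q), R_AR + R_BR ≥ I(X,Y;U₁,U₂|Z,Q), R_RA ≥ I(U₂,Z;V₂|X,U₁,Q) and R_RB ≥ I(U₁,Z;V₁|Y,U₂,Q) is such that (R_AR,R_BR,R_RA,R_RB,D_A,D_B) is achievable for DSC/delivery. -/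

import Mathlib

open scoped BigOperators

noncomputable section

namespace IRSC

attribute [local instance] Classical.propDecidable

/-- A bundled finite alphabet. -/
structure FinAlph where
  carrier : Type
  [fin : Fintype carrier]

attribute [instance] FinAlph.fin

section Basic

variable {Ω α β γ : Type*} [Fintype Ω]

/-- `μ` is a probability mass function on the finite type `Ω`. -/
def IsPMF (μ : Ω → ℝ) : Prop := (∀ ω, 0 ≤ μ ω) ∧ ∑ ω, μ ω = 1

/-- The probability that the random variable `f` takes the value `a` under `μ`. -/
def probOf (μ : Ω → ℝ) (f : Ω → α) (a : α) : ℝ := ∑ ω, if f ω = a then μ ω else 0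

/-- The expectation of the real-valued random variable `g` under `μ`. -/
def expect (μ : Ω → ℝ) (g : Ω → ℝ) : ℝ := ∑ ω, μ ω * g ω

/-- The Shannon entropy (base 2) `H(f)` of a random variable `f` under `μ`. -/
def entropy [Fintype α] (μ : Ω → ℝ) (f : Ω → α) : ℝ :=
  -∑ a, probOf μ f a * Real.logb 2 (probOf μ f a)

/-- The conditional entropy `H(f | g)` under `μ`. -/
def condEntropy [Fintype α] [Fintype β] (μ : Ω → ℝ) (f : Ω → α) (g : Ω → β) : ℝ :=
  entropy μ (fun ω => (f ω, g ω)) - entropy μ g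

/-- The conditional mutual information `I(f ; g | h)` under `μ`. -/
def condMI [Fintype α] [Fintype β] [Fintype γ]
    (μ : Ω → ℝ) (f : Ω → α) (g : Ω → β) (h : Ω → γ) : ℝ :=
  condEntropy μ f h + condEntropy μ g h - condEntropy μ (fun ω => (f ω, g ω)) h

/-- `MarkovChain μ f g h` says that `f − g − h` forms a Markov chain under `μ`, i.e.
`f` and `h` are conditionally independent given `g`. -/
def MarkovChain (μ : Ω → ℝ) (f : Ω → α) (g : Ω → β) (h : Ω → γ) : Prop :=
  ∀ a b c,
    probOf μ (fun ω => (f ω, g ω, h ω)) (a, b, c) * probOf μ g b =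
      probOf μ (fun ω => (f ω, g ω)) (a, b) * probOf μ (fun ω => (g ω, h ω)) (b, c)

end Basic

/-- The i.i.d. distribution of `n` copies of `p`. -/
def iid {W : Type*} [Fintype W] (p : W → ℝ) (n : ℕ) : (Fin n → W) → ℝ :=
  fun w => ∏ i, p (w i)

/-- The past `(x_1, …, x_{i-1})` of a sequence `x` relative to position `i`. -/
def past {n : ℕ} {α : Type*} (i : Fin n) (x : Fin n → α) : {j : Fin n // j < i} → α :=
  fun j => x j.1

/-- The future `(x_{i+1}, …, x_n)` of a sequence `x` relative to position `i`. -/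
def fut {n : ℕ} {α : Type*} (i : Fin n) (x : Fin n → α) : {j : Fin n // i < j} → α :=
  fun j => x j.1

/-- A DSC/delivery code of blocklength `n`: finite message sets, encoders
`φAR, φBR, φRA, φRB` and decoders `ΨA, ΨB`. -/
structure DSCCode (𝒳 𝒴 𝒵 Xh Yh : Type*) (n : ℕ) where
  MAR : FinAlph
  MBR : FinAlph
  MRA : FinAlph
  MRB : FinAlph
  φAR : (Fin n → 𝒳) → MAR.carrier
  φBR : (Fin n → 𝒴) → MBR.carrier
  φRA : (Fin n → 𝒵) → MAR.carrier → MBR.carrier → MRA.carrier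
  φRB : (Fin n → 𝒵) → MAR.carrier → MBR.carrier → MRB.carrier
  ΨA : (Fin n → 𝒳) → MRA.carrier → Fin n → Yh
  ΨB : (Fin n → 𝒴) → MRB.carrier → Fin n → Xh

namespace DSCCode

variable {𝒳 𝒴 𝒵 Xh Yh : Type*} {n : ℕ}

/-- The message `M_AR = φ_AR(X^n)`. -/
def mAR (C : DSCCode 𝒳 𝒴 𝒵 Xh Yh n) (w : Fin n → 𝒳 × 𝒴 × 𝒵) : C.MAR.carrier :=
  C.φAR fun i => (w i).1

/-- The message `M_BR = φ_BR(Y^n)`. -/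
def mBR (C : DSCCode 𝒳 𝒴 𝒵 Xh Yh n) (w : Fin n → 𝒳 × 𝒴 × 𝒵) : C.MBR.carrier :=
  C.φBR fun i => (w i).2.1

/-- The message `M_RA = φ_RA(Z^n, M_AR, M_BR)`. -/
def mRA (C : DSCCode 𝒳 𝒴 𝒵 Xh Yh n) (w : Fin n → 𝒳 × 𝒴 × 𝒵) : C.MRA.carrier :=
  C.φRA (fun i => (w i).2.2) (C.mAR w) (C.mBR w)

/-- The message `M_RB = φ_RB(Z^n, M_AR, M_BR)`. -/
def mRB (C : DSCCode 𝒳 𝒴 𝒵 Xh Yh n) (w : Fin n → 𝒳 × 𝒴 × 𝒵) : C.MRB.carrier :=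
  C.φRB (fun i => (w i).2.2) (C.mAR w) (C.mBR w)

/-- The reconstruction `Ŷ^n = Ψ_A(X^n, M_RA)`. -/
def Yhat (C : DSCCode 𝒳 𝒴 𝒵 Xh Yh n) (w : Fin n → 𝒳 × 𝒴 × 𝒵) : Fin n → Yh :=
  C.ΨA (fun i => (w i).1) (C.mRA w)

/-- The reconstruction `X̂^n = Ψ_B(Y^n, M_RB)`. -/
def Xhat (C : DSCCode 𝒳 𝒴 𝒵 Xh Yh n) (w : Fin n → 𝒳 × 𝒴 × 𝒵) : Fin n → Xh :=
  C.ΨB (fun i => (w i).2.1) (C.mRB w)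

/-- The average distortion `(1/n) ∑ᵢ E[d_A(Y_i, Ŷ_i)]` of the code. -/
def distA [Fintype 𝒳] [Fintype 𝒴] [Fintype 𝒵] (C : DSCCode 𝒳 𝒴 𝒵 Xh Yh n)
    (p : 𝒳 × 𝒴 × 𝒵 → ℝ) (dA : 𝒴 → Yh → ℝ) : ℝ :=
  (1 / n : ℝ) * ∑ i, expect (iid p n) fun w => dA (w i).2.1 (C.Yhat w i)

/-- The average distortion `(1/n) ∑ᵢ E[d_B(X_i, X̂_i)]` of the code. -/
def distB [Fintype 𝒳] [Fintype 𝒴] [Fintype 𝒵] (C : DSCCode 𝒳 𝒴 𝒵 Xh Yh n)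
    (p : 𝒳 × 𝒴 × 𝒵 → ℝ) (dB : 𝒳 → Xh → ℝ) : ℝ :=
  (1 / n : ℝ) * ∑ i, expect (iid p n) fun w => dB (w i).1 (C.Xhat w i)

end DSCCode

/-- Achievability of `(R_AR, R_BR, R_RA, R_RB, D_A, D_B)` for the DSC/delivery scheme. -/
def DSCAchievable {𝒳 𝒴 𝒵 Xh Yh : Type*} [Fintype 𝒳] [Fintype 𝒴] [Fintype 𝒵]
    (p : 𝒳 × 𝒴 × 𝒵 → ℝ) (dA : 𝒴 → Yh → ℝ) (dB : 𝒳 → Xh → ℝ)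
    (RAR RBR RRA RRB DA DB : ℝ) : Prop :=
  ∀ ε > (0 : ℝ), ∃ N : ℕ, ∀ n ≥ N, ∃ C : DSCCode 𝒳 𝒴 𝒵 Xh Yh n,
    (Fintype.card C.MAR.carrier : ℝ) ≤ (2 : ℝ) ^ ((n : ℝ) * (RAR + ε)) ∧
    (Fintype.card C.MBR.carrier : ℝ) ≤ (2 : ℝ) ^ ((n : ℝ) * (RBR + ε)) ∧
    (Fintype.card C.MRA.carrier : ℝ) ≤ (2 : ℝ) ^ ((n : ℝ) * (RRA + ε)) ∧
    (Fintype.card C.MRB.carrier : ℝ) ≤ (2 : ℝ) ^ ((n : ℝ) * (RRB + ε)) ∧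
    C.distA p dA ≤ DA + ε ∧ C.distB p dB ≤ DB + ε


section ExpectBasics

variable {Ω Ω' : Type*} [Fintype Ω] [Fintype Ω']

/-- Real-valued indicator. -/
def ind (P : Prop) : ℝ := if P then 1 else 0

lemma ind_nonneg (P : Prop) : 0 ≤ ind P := by unfold ind; split_ifs <;> norm_num
lemma ind_le_one (P : Prop) : ind P ≤ 1 := by unfold ind; split_ifs <;> norm_num
lemma ind_true {P : Prop} (h : P) : ind P = 1 := by simp [ind, h]
lemma ind_false {P : Prop} (h : ¬ P) : ind P = 0 := by simp [ind, h]

lemma ind_mono {P R : Prop} (h : P → R) : ind P ≤ ind R := by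
  by_cases hP : P
  · rw [ind_true hP, ind_true (h hP)]
  · rw [ind_false hP]; exact ind_nonneg _

lemma ind_or_le (P R : Prop) : ind (P ∨ R) ≤ ind P + ind R := by
  by_cases hP : P <;> by_cases hR : R <;> simp [ind, hP, hR]

lemma expect_add (μ : Ω → ℝ) (g h : Ω → ℝ) :
    expect μ (fun ω => g ω + h ω) = expect μ g + expect μ h := by
  simp [expect, mul_add, Finset.sum_add_distrib]

lemma expect_const_mul (μ : Ω → ℝ) (a : ℝ) (g : Ω → ℝ) :
    expect μ (fun ω => a * g ω) = a * expect μ g := by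
  simp only [expect, Finset.mul_sum]
  exact Finset.sum_congr rfl fun _ _ => by ring

lemma expect_neg (μ : Ω → ℝ) (g : Ω → ℝ) :
    expect μ (fun ω => - g ω) = - expect μ g := by
  simp [expect]

lemma expect_sub (μ : Ω → ℝ) (g h : Ω → ℝ) :
    expect μ (fun ω => g ω - h ω) = expect μ g - expect μ h := by
  simp [expect, mul_sub, Finset.sum_sub_distrib]

lemma expect_sum {ι : Type*} (s : Finset ι) (μ : Ω → ℝ) (g : ι → Ω → ℝ) :
    expect μ (fun ω => ∑ i ∈ s, g i ω) = ∑ i ∈ s, expect μ (g i) := by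
  simp only [expect, Finset.mul_sum]
  rw [Finset.sum_comm]

lemma expect_const {μ : Ω → ℝ} (hμ : IsPMF μ) (a : ℝ) : expect μ (fun _ => a) = a := by
  simp [expect, ← Finset.sum_mul, hμ.2]

lemma expect_mono' {μ : Ω → ℝ} (hμ : ∀ ω, 0 ≤ μ ω) {g h : Ω → ℝ}
    (hgh : ∀ ω, 0 < μ ω → g ω ≤ h ω) : expect μ g ≤ expect μ h := by
  refine Finset.sum_le_sum fun ω _ => ?_
  rcases (hμ ω).eq_or_lt with h0 | h0
  · simp [← h0]
  · exact mul_le_mul_of_nonneg_left (hgh ω h0) h0.le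

lemma expect_mono {μ : Ω → ℝ} (hμ : IsPMF μ) {g h : Ω → ℝ}
    (hgh : ∀ ω, g ω ≤ h ω) : expect μ g ≤ expect μ h :=
  expect_mono' hμ.1 fun ω _ => hgh ω

lemma expect_nonneg {μ : Ω → ℝ} (hμ : IsPMF μ) {g : Ω → ℝ}
    (hg : ∀ ω, 0 ≤ g ω) : 0 ≤ expect μ g :=
  Finset.sum_nonneg fun ω _ => mul_nonneg (hμ.1 ω) (hg ω)

lemma expect_le_const {μ : Ω → ℝ} (hμ : IsPMF μ) {g : Ω → ℝ} {a : ℝ}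
    (hg : ∀ ω, g ω ≤ a) : expect μ g ≤ a := by
  calc expect μ g ≤ expect μ (fun _ => a) := expect_mono hμ hg
    _ = a := expect_const hμ a

lemma expect_comm (μ : Ω → ℝ) (ν : Ω' → ℝ) (g : Ω → Ω' → ℝ) :
    expect μ (fun a => expect ν fun b => g a b) =
      expect ν (fun b => expect μ fun a => g a b) := by
  simp only [expect, Finset.mul_sum]
  rw [Finset.sum_comm]
  exact Finset.sum_congr rfl fun _ _ => Finset.sum_congr rfl fun _ _ => by ring

lemma exists_le_expect {μ : Ω → ℝ} (hμ : IsPMF μ) {g : Ω → ℝ} {B : ℝ}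
    (h : expect μ g ≤ B) : ∃ ω, g ω ≤ B := by
  by_contra hcon
  push Not at hcon
  have h1 : ∃ ω ∈ Finset.univ, 0 < μ ω := by
    by_contra hno
    push Not at hno
    have : ∑ ω, μ ω ≤ 0 := Finset.sum_nonpos hno
    rw [hμ.2] at this
    linarith
  obtain ⟨ω0, _, h0⟩ := h1
  have : expect μ (fun _ => B) < expect μ g := by
    refine Finset.sum_lt_sum (fun ω _ => mul_le_mul_of_nonneg_left (hcon ω).le (hμ.1 ω))
      ⟨ω0, Finset.mem_univ _, mul_lt_mul_of_pos_left (hcon ω0) h0⟩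
  rw [expect_const hμ] at this
  linarith

lemma IsPMF.nonempty {μ : Ω → ℝ} (hμ : IsPMF μ) : Nonempty Ω := by
  by_contra h
  rw [not_nonempty_iff] at h
  have := hμ.2
  simp at this

lemma expect_abs_sq_le {μ : Ω → ℝ} (hμ : IsPMF μ) (g : Ω → ℝ) :
    expect μ (fun ω => |g ω|) ^ 2 ≤ expect μ (fun ω => g ω ^ 2) := by
  set m := expect μ (fun ω => |g ω|) with hm
  have h0 : 0 ≤ expect μ (fun ω => (|g ω| - m) ^ 2) := expect_nonneg hμ fun _ => sq_nonneg _
  have h1 : expect μ (fun ω => (|g ω| - m) ^ 2) =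
      expect μ (fun ω => g ω ^ 2) - (2 * m) * m + m ^ 2 := by
    have : (fun ω => (|g ω| - m) ^ 2) = fun ω => (g ω ^ 2 - (2 * m) * |g ω|) + m ^ 2 := by
      funext ω; rw [sub_sq, sq_abs]; ring
    rw [this, expect_add, expect_const hμ, expect_sub, expect_const_mul, ← hm]
  nlinarith

/-- Derandomisation of a stochastic map. -/
lemma exists_fun_le {S V : Type*} [Fintype S] [Fintype V] (P : Ω → ℝ) (f : Ω → S)
    (K : S → V → ℝ) (hK : ∀ s, IsPMF (K s)) (c : Ω → V → ℝ) :
    ∃ e : S → V, expect P (fun ω => c ω (e (f ω))) ≤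
      expect P (fun ω => expect (K (f ω)) fun v => c ω v) := by
  have key : ∀ s, ∃ v, (∑ ω, if f ω = s then P ω * c ω v else 0) ≤
      expect (K s) (fun v => ∑ ω, if f ω = s then P ω * c ω v else 0) :=
    fun s => exists_le_expect (hK s) le_rfl
  choose e he using key
  refine ⟨e, ?_⟩
  have h := Finset.sum_le_sum fun s (_ : s ∈ Finset.univ) => he s
  have e1 : ∑ s, (∑ ω, if f ω = s then P ω * c ω (e s) else 0) =
      expect P (fun ω => c ω (e (f ω))) := by
    rw [Finset.sum_comm]
    simp [expect]
  have e2 : ∑ s, expect (K s) (fun v => ∑ ω, if f ω = s then P ω * c ω v else 0) =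
      expect P (fun ω => expect (K (f ω)) fun v => c ω v) := by
    have : ∀ s, expect (K s) (fun v => ∑ ω, if f ω = s then P ω * c ω v else 0) =
        ∑ ω, if f ω = s then P ω * expect (K s) (fun v => c ω v) else 0 := by
      intro s
      rw [expect_sum]
      refine Finset.sum_congr rfl fun ω _ => ?_
      by_cases h : f ω = s
      · simp only [h, if_true]; rw [expect_const_mul]
      · simp [h, expect]
    simp only [this]
    rw [Finset.sum_comm]
    simp only [expect, Finset.sum_ite_eq, Finset.mem_univ, if_true]
  rw [← e1, ← e2]; exact h

end ExpectBasics

section ProdW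

set_option linter.unusedSectionVars false

variable {I A : Type*} [Fintype I] [DecidableEq I] [Fintype A]

/-- Product weights on functions. -/
def prodW (I : Type*) [Fintype I] {A : Type*} (ν : A → ℝ) : (I → A) → ℝ := fun w => ∏ i, ν (w i)

lemma sum_prod_fun (g : I → A → ℝ) : ∑ w : I → A, ∏ i, g i (w i) = ∏ i, ∑ a, g i a := by
  have := Finset.sum_prod_piFinset (Finset.univ : Finset A) g
  simpa using this

lemma prodW_isPMF {ν : A → ℝ} (hν : IsPMF ν) : IsPMF (prodW I ν) := by
  refine ⟨fun w => Finset.prod_nonneg fun i _ => hν.1 _, ?_⟩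
  unfold prodW
  rw [sum_prod_fun (fun _ a => ν a)]
  simp [hν.2]

lemma expect_prodW_single {ν : A → ℝ} (hν : IsPMF ν) (i : I) (g : A → ℝ) :
    expect (prodW I ν) (fun w => g (w i)) = expect ν g := by
  have h : ∀ w : I → A, prodW I ν w * g (w i) =
      ∏ k, (ν (w k) * if k = i then g (w k) else 1) := by
    intro w
    rw [Finset.prod_mul_distrib]
    simp [prodW]
  unfold expect
  simp only [h]
  rw [sum_prod_fun (fun k a => ν a * if k = i then g a else 1)]
  rw [Finset.prod_eq_single i]
  · simp
  · intro k _ hk; simp [hk, hν.2]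
  · simp

lemma expect_prodW_pair {ν : A → ℝ} (hν : IsPMF ν) {i j : I} (hij : i ≠ j) (g h : A → ℝ) :
    expect (prodW I ν) (fun w => g (w i) * h (w j)) = expect ν g * expect ν h := by
  have h1 : ∀ w : I → A, prodW I ν w * (g (w i) * h (w j)) =
      ∏ k, (ν (w k) * ((if k = i then g (w k) else 1) * if k = j then h (w k) else 1)) := by
    intro w
    rw [Finset.prod_mul_distrib, Finset.prod_mul_distrib]
    simp [prodW]
  unfold expect
  simp only [h1]
  rw [sum_prod_fun (fun k a => ν a * ((if k = i then g a else 1) * if k = j then h a else 1))]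
  rw [← Finset.mul_prod_erase _ _ (Finset.mem_univ i),
    ← Finset.mul_prod_erase _ _ (Finset.mem_erase.2 ⟨hij.symm, Finset.mem_univ j⟩)]
  rw [Finset.prod_eq_one (s := (Finset.univ.erase i).erase j)]
  · simp [hij, hij.symm]
  · intro k hk
    simp only [Finset.mem_erase] at hk
    simp [hk.1, hk.2.1, hν.2]

lemma expect_prodW_sq {ν : A → ℝ} (hν : IsPMF ν) (a : I → ℝ) (g : A → ℝ)
    (hg : expect ν g = 0) :
    expect (prodW I ν) (fun w => (∑ i, a i * g (w i)) ^ 2) =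
      (∑ i, a i ^ 2) * expect ν (fun x => g x ^ 2) := by
  have h1 : ∀ w : I → A, (∑ i, a i * g (w i)) ^ 2 =
      ∑ i, ∑ j, (a i * a j) * (g (w i) * g (w j)) := by
    intro w
    rw [sq, Finset.sum_mul_sum]
    exact Finset.sum_congr rfl fun _ _ => Finset.sum_congr rfl fun _ _ => by ring
  simp only [h1]
  rw [expect_sum, Finset.sum_mul]
  refine Finset.sum_congr rfl fun i _ => ?_
  rw [expect_sum, Finset.sum_eq_single i]
  · rw [expect_const_mul]
    have := expect_prodW_single hν i (fun x => g x ^ 2)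
    simp only [← sq]
    rw [this]
  · intro j _ hj
    rw [expect_const_mul, expect_prodW_pair hν (Ne.symm hj), hg]; ring
  · simp

/-- kernel composition step for product weights. -/
lemma expect_prodW_kernel {B : Type*} [Fintype B] (ν : A → ℝ) (κ : A → B → ℝ)
    (G : (I → A) → (I → B) → ℝ) :
    expect (prodW I ν) (fun w => expect (fun b : I → B => ∏ i, κ (w i) (b i)) fun b => G w b) =
      expect (prodW I (fun ab : A × B => ν ab.1 * κ ab.1 ab.2))
        (fun w => G (fun i => (w i).1) (fun i => (w i).2)) := by
  unfold expect
  rw [← (Equiv.arrowProdEquivProdArrow I (fun _ => A) (fun _ => B)).symm.sum_comp]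
  rw [Fintype.sum_prod_type]
  refine Finset.sum_congr rfl fun a _ => ?_
  rw [Finset.mul_sum]
  refine Finset.sum_congr rfl fun b _ => ?_
  simp only [prodW, Equiv.arrowProdEquivProdArrow, Equiv.coe_fn_symm_mk, Finset.prod_mul_distrib]
  ring

lemma kernel_isPMF {B : Type*} [Fintype B] {ν : A → ℝ} {κ : A → B → ℝ} (hν : IsPMF ν)
    (hκ : ∀ a, IsPMF (κ a)) : IsPMF (fun ab : A × B => ν ab.1 * κ ab.1 ab.2) := by
  refine ⟨fun ab => mul_nonneg (hν.1 _) ((hκ _).1 _), ?_⟩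
  rw [Fintype.sum_prod_type]
  simp [← Finset.mul_sum, (hκ _).2, hν.2]

lemma prodKernel_isPMF {B : Type*} [Fintype B] {κ : A → B → ℝ}
    (hκ : ∀ a, IsPMF (κ a)) (w : I → A) : IsPMF (fun b : I → B => ∏ i, κ (w i) (b i)) := by
  refine ⟨fun b => Finset.prod_nonneg fun i _ => (hκ _).1 _, ?_⟩
  rw [sum_prod_fun (fun i b => κ (w i) b)]
  simp [(hκ _).2]

lemma prodKernel_sub {B : Type*} [Fintype B] {κ : A → B → ℝ}
    (h0 : ∀ a b, 0 ≤ κ a b) (h1 : ∀ a, ∑ b, κ a b ≤ 1) (w : I → A) :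
    ∑ b : I → B, ∏ i, κ (w i) (b i) ≤ 1 := by
  rw [sum_prod_fun (fun i b => κ (w i) b)]
  exact Finset.prod_le_one (fun i _ => Finset.sum_nonneg fun b _ => h0 _ _) fun i _ => h1 _

end ProdW

section Binning

variable {V : Type*} [Fintype V]

/-- uniform distribution on `Fin F`. -/
def unifF (F : ℕ) : Fin F → ℝ := fun _ => 1 / (F : ℝ)

lemma unifF_isPMF {F : ℕ} (hF : 0 < F) : IsPMF (unifF F) := by
  have : (F : ℝ) ≠ 0 := by positivity
  refine ⟨fun _ => by unfold unifF; positivity, ?_⟩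
  simp [unifF, this]

lemma expect_unif_ind {F : ℕ} (i : Fin F) :
    expect (unifF F) (fun x => ind (x = i)) = 1 / F := by
  simp [expect, unifF, ind]

/-- Uniform random binning. -/
def rbin (V : Type*) [Fintype V] (F : ℕ) : (V → Fin F) → ℝ := prodW V (unifF F)

lemma rbin_isPMF {F : ℕ} (hF : 0 < F) : IsPMF (rbin V F) := prodW_isPMF (unifF_isPMF hF)

lemma rbin_collision {F : ℕ} (hF : 0 < F) {u v : V} (huv : u ≠ v) :
    expect (rbin V F) (fun f => ind (f u = f v)) = 1 / F := by
  have hF' : (F : ℝ) ≠ 0 := by positivity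
  have h : ∀ f : V → Fin F, ind (f u = f v) = ∑ i, ind (f u = i) * ind (f v = i) := by
    intro f
    rw [Finset.sum_eq_single (f v)]
    · simp [ind]
    · intro i _ hi; simp [ind, Ne.symm hi]
    · simp
  simp only [h]
  rw [expect_sum]
  have h2 : ∀ i : Fin F, expect (rbin V F) (fun f => ind (f u = i) * ind (f v = i)) =
      1 / F * (1 / F) := by
    intro i
    have := expect_prodW_pair (unifF_isPMF hF) huv (fun x => ind (x = i)) (fun x => ind (x = i))
    rw [expect_unif_ind] at this
    exact this
  simp only [h2]
  simp
  field_simp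

/-- probability of the bin `i`. -/
def binP {F : ℕ} (K : V → ℝ) (f : V → Fin F) (i : Fin F) : ℝ := expect K (fun v => ind (f v = i))

/-- L1 deviation of the bin index from uniform. -/
def binDev {F : ℕ} (K : V → ℝ) (f : V → Fin F) : ℝ := ∑ i, |1 / (F : ℝ) - binP K f i|

/-- distribution conditioned on the bin. -/
def condBin {F : ℕ} (K : V → ℝ) (f : V → Fin F) (i : Fin F) : V → ℝ :=
  fun v => if binP K f i = 0 then K v else K v * ind (f v = i) / binP K f i

lemma binP_nonneg {F : ℕ} {K : V → ℝ} (hK : IsPMF K) (f : V → Fin F) (i : Fin F) :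
    0 ≤ binP K f i := expect_nonneg hK fun _ => ind_nonneg _

lemma condBin_isPMF {F : ℕ} {K : V → ℝ} (hK : IsPMF K) (f : V → Fin F) (i : Fin F) :
    IsPMF (condBin K f i) := by
  unfold condBin
  by_cases h : binP K f i = 0
  · simpa [h] using hK
  · simp only [h, if_false]
    refine ⟨fun v => div_nonneg (mul_nonneg (hK.1 v) (ind_nonneg _)) (binP_nonneg hK f i), ?_⟩
    rw [← Finset.sum_div]
    exact div_self h

lemma condBin_mul {F : ℕ} {K : V → ℝ} (hK : IsPMF K) (f : V → Fin F) (i : Fin F) (v : V) :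
    binP K f i * condBin K f i v = K v * ind (f v = i) := by
  unfold condBin
  by_cases h : binP K f i = 0
  · simp only [h, if_true, zero_mul]
    have := (Finset.sum_eq_zero_iff_of_nonneg
      (fun v _ => mul_nonneg (hK.1 v) (ind_nonneg (f v = i)))).1 h v (Finset.mem_univ _)
    exact this.symm
  · simp only [h, if_false]
    field_simp

/-- Replacement lemma: shared uniform bin index versus ideal distribution. -/
lemma replace_le {F : ℕ} {K : V → ℝ} (hK : IsPMF K) (f : V → Fin F)
    (c : Fin F → V → ℝ) (h0 : ∀ i v, 0 ≤ c i v) (h1 : ∀ i v, c i v ≤ 1) :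
    expect (unifF F) (fun i => expect (condBin K f i) fun v => c i v) ≤
      expect K (fun v => c (f v) v) + binDev K f := by
  have e1 : expect K (fun v => c (f v) v) =
      ∑ i, binP K f i * expect (condBin K f i) (fun v => c i v) := by
    have : ∀ i, binP K f i * expect (condBin K f i) (fun v => c i v) =
        ∑ v, K v * (ind (f v = i) * c i v) := by
      intro i
      unfold expect
      rw [Finset.mul_sum]
      refine Finset.sum_congr rfl fun v _ => ?_
      rw [← mul_assoc, condBin_mul hK]; ring
    simp only [this]
    rw [Finset.sum_comm]
    refine Finset.sum_congr rfl fun v _ => ?_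
    rw [← Finset.mul_sum]
    simp [ind]
  rw [e1]
  unfold binDev
  rw [← Finset.sum_add_distrib]
  refine Finset.sum_le_sum fun i _ => ?_
  have a0 : 0 ≤ expect (condBin K f i) (fun v => c i v) :=
    expect_nonneg (condBin_isPMF hK f i) (h0 i)
  have a1 : expect (condBin K f i) (fun v => c i v) ≤ 1 :=
    expect_le_const (condBin_isPMF hK f i) (h1 i)
  have a2 := le_abs_self (1 / (F : ℝ) - binP K f i)
  have a3 := abs_nonneg (1 / (F : ℝ) - binP K f i)
  simp only [unifF]
  nlinarith [mul_le_mul_of_nonneg_right a2 a0, mul_le_mul_of_nonneg_left a1 a3]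

lemma expect_binDev_le {F : ℕ} (hF : 0 < F) {K : V → ℝ} (hK : IsPMF K) {τ : ℝ} (hτ : 0 ≤ τ) :
    expect (rbin V F) (fun f => binDev K f) ≤
      2 * expect K (fun v => ind (τ < K v)) + Real.sqrt ((F - 1) * τ) := by
  have hF' : (0 : ℝ) < F := by exact_mod_cast hF
  have hF1 : (1 : ℝ) ≤ F := by exact_mod_cast hF
  set K' : V → ℝ := fun v => if K v ≤ τ then K v else 0 with hK'
  have hK'sq : ∑ v, K' v ^ 2 ≤ τ := by
    calc ∑ v, K' v ^ 2 ≤ ∑ v, τ * K v := by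
          refine Finset.sum_le_sum fun v _ => ?_
          simp only [hK']
          split_ifs with h
          · rw [sq]; exact mul_le_mul_of_nonneg_right h (hK.1 v)
          · simpa using mul_nonneg hτ (hK.1 v)
      _ = τ := by rw [← Finset.mul_sum, hK.2, mul_one]
  have hpt : ∀ (f : V → Fin F), binDev K f ≤
      2 * expect K (fun v => ind (τ < K v)) +
        ∑ i, |∑ v, K' v * (ind (f v = i) - 1 / F)| := by
    intro f
    have hA : ∀ i, |1 / (F : ℝ) - binP K f i| ≤
        (∑ v, K v * ind (τ < K v) * (ind (f v = i) + 1 / F)) +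
          |∑ v, K' v * (ind (f v = i) - 1 / F)| := by
      intro i
      have e : binP K f i - 1 / (F : ℝ) = (∑ v, K v * ind (τ < K v) * (ind (f v = i) - 1 / F)) +
          ∑ v, K' v * (ind (f v = i) - 1 / F) := by
        rw [← Finset.sum_add_distrib]
        have : (1 / (F : ℝ)) = ∑ v, K v * (1 / F) := by rw [← Finset.sum_mul, hK.2, one_mul]
        rw [this, binP, expect, ← Finset.sum_sub_distrib]
        refine Finset.sum_congr rfl fun v _ => ?_
        rw [← this]
        simp only [hK']
        by_cases h : K v ≤ τ
        · rw [if_pos h, ind_false (not_lt.2 h)]; ring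
        · rw [if_neg h, ind_true (not_le.1 h)]; ring
      rw [abs_sub_comm, e]
      refine (abs_add_le _ _).trans (add_le_add ?_ le_rfl)
      refine (Finset.abs_sum_le_sum_abs _ _).trans (Finset.sum_le_sum fun v _ => ?_)
      rw [abs_mul, abs_of_nonneg (mul_nonneg (hK.1 v) (ind_nonneg _))]
      refine mul_le_mul_of_nonneg_left ?_ (mul_nonneg (hK.1 v) (ind_nonneg _))
      have h3 : (0 : ℝ) ≤ 1 / F := by positivity
      have h4 := ind_nonneg (f v = i)
      rw [abs_le]; constructor <;> linarith
    refine (Finset.sum_le_sum fun i _ => hA i).trans ?_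
    rw [Finset.sum_add_distrib]
    refine add_le_add (le_of_eq ?_) le_rfl
    rw [Finset.sum_comm, expect, Finset.mul_sum]
    refine Finset.sum_congr rfl fun v _ => ?_
    rw [← Finset.mul_sum, Finset.sum_add_distrib]
    have : ∑ i, ind (f v = i) = 1 := by
      rw [Finset.sum_eq_single (f v)]
      · exact ind_true rfl
      · intro i _ hi; exact ind_false (Ne.symm hi)
      · simp
    rw [this]
    simp
    field_simp
    ring
  refine (expect_mono (rbin_isPMF hF) hpt).trans ?_
  rw [expect_add, expect_const (rbin_isPMF hF)]
  refine add_le_add le_rfl ?_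
  rw [expect_sum]
  have hvar : ∀ i : Fin F, expect (rbin V F) (fun f => |∑ v, K' v * (ind (f v = i) - 1 / F)|) ≤
      Real.sqrt ((F - 1) * τ) / F := by
    intro i
    have h1 := expect_abs_sq_le (rbin_isPMF hF) (fun f : V → Fin F =>
      ∑ v, K' v * (ind (f v = i) - 1 / F))
    have hmean : expect (unifF F) (fun x => ind (x = i) - 1 / (F : ℝ)) = 0 := by
      rw [expect_sub, expect_unif_ind, expect_const (unifF_isPMF hF)]; simp
    have h2 := expect_prodW_sq (I := V) (unifF_isPMF hF) K' (fun x => ind (x = i) - 1 / (F : ℝ)) hmean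
    have h3 : expect (unifF F) (fun x => (ind (x = i) - 1 / (F : ℝ)) ^ 2) = (F - 1) / F ^ 2 := by
      have : (fun x : Fin F => (ind (x = i) - 1 / (F : ℝ)) ^ 2) =
          fun x => (1 - 2 / (F : ℝ)) * ind (x = i) + 1 / (F : ℝ) ^ 2 := by
        funext x
        by_cases h : x = i
        · simp [ind, h]; ring
        · simp [ind, h]
      rw [this, expect_add, expect_const_mul, expect_unif_ind, expect_const (unifF_isPMF hF)]
      field_simp
      ring
    rw [h3] at h2
    have h4 : expect (rbin V F) (fun f => |∑ v, K' v * (ind (f v = i) - 1 / F)|) ^ 2 ≤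
        ((F - 1) * τ) / F ^ 2 := by
      refine h1.trans ?_
      rw [rbin, h2]
      have : (0:ℝ) ≤ (F - 1) / F ^ 2 := by
        apply div_nonneg <;> [linarith; positivity]
      calc (∑ v, K' v ^ 2) * ((F - 1) / (F:ℝ) ^ 2) ≤ τ * ((F - 1) / (F:ℝ) ^ 2) :=
            mul_le_mul_of_nonneg_right hK'sq this
        _ = _ := by ring
    have h5 := Real.le_sqrt_of_sq_le h4
    rwa [Real.sqrt_div' _ (by positivity), Real.sqrt_sq hF'.le] at h5
  refine (Finset.sum_le_sum fun i _ => hvar i).trans (le_of_eq ?_)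
  simp
  field_simp

/-- Counting lemma: few sequences have large conditional probability. -/
lemma count_le {r : V → ℝ} (h0 : ∀ v, 0 ≤ r v) (h1 : ∑ v, r v ≤ 1) {l : ℝ} (hl : 0 < l) :
    ∑ v, ind (l < r v) ≤ 1 / l := by
  rw [le_div_iff₀ hl, Finset.sum_mul]
  refine (Finset.sum_le_sum fun v _ => ?_).trans h1
  by_cases h : l < r v
  · simpa [ind, h] using h.le
  · simpa [ind, h] using h0 v

end Binning

section OneShot

/-- Threshold decoder. -/
def decTh {V : Type*} [Nonempty V] {F M : ℕ} (l : ℝ) (r : V → ℝ) (f : V → Fin F) (m : V → Fin M)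
    (i : Fin F) (j : Fin M) : V :=
  Classical.epsilon fun v => l < r v ∧ f v = i ∧ m v = j

/-- Collision indicator. -/
def coll {V : Type*} {F M : ℕ} (v v' : V) (f : V → Fin F) (m : V → Fin M) : ℝ :=
  ind (v' ≠ v) * ind (f v' = f v) * ind (m v' = m v)

lemma coll_nonneg {V : Type*} {F M : ℕ} (v v' : V) (f : V → Fin F) (m : V → Fin M) :
    0 ≤ coll v v' f m :=
  mul_nonneg (mul_nonneg (ind_nonneg _) (ind_nonneg _)) (ind_nonneg _)

lemma decTh_err {V : Type*} [Fintype V] [Nonempty V] {F M : ℕ} (l : ℝ) (r : V → ℝ)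
    (f : V → Fin F) (m : V → Fin M) (v : V) :
    ind (decTh l r f m (f v) (m v) ≠ v) ≤ ind (r v ≤ l) +
      ∑ v', ind (l < r v') * coll v v' f m := by
  have hnn : ∀ v', 0 ≤ ind (l < r v') * coll v v' f m :=
    fun v' => mul_nonneg (ind_nonneg _) (coll_nonneg _ _ _ _)
  by_cases h : decTh l r f m (f v) (m v) = v
  · rw [ind_false (by simpa using h)]
    exact add_nonneg (ind_nonneg _) (Finset.sum_nonneg fun v' _ => hnn v')
  rw [ind_true h]
  by_cases h1 : r v ≤ l
  · rw [ind_true h1]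
    linarith [Finset.sum_nonneg fun v' (_ : v' ∈ Finset.univ) => hnn v']
  · have hs : l < r (decTh l r f m (f v) (m v)) ∧ f (decTh l r f m (f v) (m v)) = f v ∧
        m (decTh l r f m (f v) (m v)) = m v :=
      Classical.epsilon_spec (p := fun v' => l < r v' ∧ f v' = f v ∧ m v' = m v)
        ⟨v, not_le.1 h1, rfl, rfl⟩
    have := Finset.single_le_sum (fun v' _ => hnn v')
      (Finset.mem_univ (decTh l r f m (f v) (m v)))
    rw [coll, ind_true hs.1, ind_true hs.2.1, ind_true hs.2.2, ind_true h] at this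
    linarith [ind_nonneg (r v ≤ l)]

lemma expect_coll {V : Type*} [Fintype V] {F M : ℕ} (hF : 0 < F) (hM : 0 < M) (v v' : V) :
    expect (rbin V F) (fun f => expect (rbin V M) fun m =>
      coll v v' f m) ≤ 1 / (F * M) := by
  unfold coll
  by_cases h : v' = v
  · have : ind (v' ≠ v) = 0 := ind_false (by simpa using h)
    simp only [this, zero_mul]
    rw [expect_const (rbin_isPMF hM), expect_const (rbin_isPMF hF)]
    positivity
  · simp only [ind_true h, one_mul, expect_const_mul, rbin_collision hM h]
    simp only [mul_comm _ (1 / (M : ℝ)), expect_const_mul, rbin_collision hF h]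
    apply le_of_eq
    field_simp

lemma expect_decTh_err {V : Type*} [Fintype V] [Nonempty V] {F M : ℕ} (hF : 0 < F) (hM : 0 < M)
    {l : ℝ} (hl : 0 < l) {r : V → ℝ} (h0 : ∀ v, 0 ≤ r v) (h1 : ∑ v, r v ≤ 1) (v : V) :
    expect (rbin V F) (fun f => expect (rbin V M) fun m =>
      ind (decTh l r f m (f v) (m v) ≠ v)) ≤ ind (r v ≤ l) + 1 / (F * M * l) := by
  refine (expect_mono (rbin_isPMF hF) fun f => expect_mono (rbin_isPMF hM) fun m =>
    decTh_err l r f m v).trans ?_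
  simp only [expect_add, expect_const (rbin_isPMF hM), expect_const (rbin_isPMF hF), expect_sum,
    expect_const_mul]
  refine add_le_add le_rfl ?_
  calc _ ≤ ∑ v', ind (l < r v') * (1 / (F * M)) :=
        Finset.sum_le_sum fun v' _ => mul_le_mul_of_nonneg_left (expect_coll hF hM v v')
          (ind_nonneg _)
    _ = (∑ v', ind (l < r v')) * (1 / (F * M)) := by rw [Finset.sum_mul]
    _ ≤ 1 / l * (1 / (F * M)) :=
        mul_le_mul_of_nonneg_right (count_le h0 h1 hl) (by positivity)
    _ = _ := by rw [one_div_mul_one_div, mul_comm l]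

/-- One-shot Wyner-Ziv lemma. -/
lemma oneshot_WZ {Ω S T V : Type*} [Fintype Ω] [Fintype S] [Fintype T] [Fintype V] [Nonempty V]
    {P : Ω → ℝ} (hP : IsPMF P) (s : Ω → S) (t : Ω → T)
    {K : S → V → ℝ} (hK : ∀ s, IsPMF (K s))
    {r : T → V → ℝ} (hr0 : ∀ t v, 0 ≤ r t v) (hr1 : ∀ t, ∑ v, r t v ≤ 1)
    {c : Ω → V → ℝ} (hc0 : ∀ ω v, 0 ≤ c ω v) (hc1 : ∀ ω v, c ω v ≤ 1)
    {F M : ℕ} (hF : 0 < F) (hM : 0 < M) {τ l : ℝ} (hτ : 0 ≤ τ) (hl : 0 < l) :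
    ∃ (k : V → Fin M) (e : S → V) (d : T → Fin M → V),
      expect P (fun ω => c ω (d (t ω) (k (e (s ω))))) ≤
        expect P (fun ω => expect (K (s ω)) fun v => c ω v) +
        2 * expect P (fun ω => expect (K (s ω)) fun v => ind (τ < K (s ω) v)) +
        expect P (fun ω => expect (K (s ω)) fun v => ind (r (t ω) v ≤ l)) +
        Real.sqrt ((F - 1) * τ) + 1 / (F * M * l) := by
  have hf := rbin_isPMF (V := V) hF
  have hm := rbin_isPMF (V := V) hM
  -- real cost
  have main : expect (rbin V F) (fun f => expect (rbin V M) fun m => expect (unifF F) fun i =>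
      expect P fun ω => expect (condBin (K (s ω)) f i) fun v =>
        c ω (decTh l (r (t ω)) f m i (m v))) ≤
        expect P (fun ω => expect (K (s ω)) fun v => c ω v) +
        2 * expect P (fun ω => expect (K (s ω)) fun v => ind (τ < K (s ω) v)) +
        expect P (fun ω => expect (K (s ω)) fun v => ind (r (t ω) v ≤ l)) +
        Real.sqrt ((F - 1) * τ) + 1 / (F * M * l) := by
    have step1 : ∀ f : V → Fin F, ∀ m : V → Fin M, (expect (unifF F) fun i =>
        expect P fun ω => expect (condBin (K (s ω)) f i) fun v =>
          c ω (decTh l (r (t ω)) f m i (m v))) ≤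
        expect P fun ω => (expect (K (s ω)) fun v =>
          c ω v + ind (decTh l (r (t ω)) f m (f v) (m v) ≠ v)) + binDev (K (s ω)) f := by
      intro f m
      rw [expect_comm]
      refine expect_mono hP fun ω => ?_
      refine (replace_le (hK (s ω)) f (fun i v => c ω (decTh l (r (t ω)) f m i (m v)))
        (fun _ _ => hc0 _ _) (fun _ _ => hc1 _ _)).trans (add_le_add ?_ le_rfl)
      refine expect_mono (hK (s ω)) fun v => ?_
      by_cases h : decTh l (r (t ω)) f m (f v) (m v) = v
      · rw [h]; linarith [ind_nonneg (v ≠ v)]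
      · rw [ind_true h]; linarith [hc0 ω v, hc1 ω (decTh l (r (t ω)) f m (f v) (m v))]
    refine (expect_mono hf fun f => expect_mono hm fun m => step1 f m).trans ?_
    have e1 : expect (rbin V F) (fun f => expect (rbin V M) fun m =>
        expect P fun ω => (expect (K (s ω)) fun v =>
          c ω v + ind (decTh l (r (t ω)) f m (f v) (m v) ≠ v)) + binDev (K (s ω)) f) =
        expect P fun ω => (expect (K (s ω)) fun v =>
          c ω v + expect (rbin V F) fun f => expect (rbin V M) fun m =>
            ind (decTh l (r (t ω)) f m (f v) (m v) ≠ v)) +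
          expect (rbin V F) fun f => binDev (K (s ω)) f := by
      calc _ = expect (rbin V F) (fun f => expect P fun ω => expect (rbin V M) fun m =>
            (expect (K (s ω)) fun v =>
              c ω v + ind (decTh l (r (t ω)) f m (f v) (m v) ≠ v)) + binDev (K (s ω)) f) := by
            congr 1; funext f; rw [expect_comm]
        _ = _ := by
            rw [expect_comm]
            congr 1; funext ω
            simp only [expect_add, expect_const hm, expect_const hf]
            simp only [expect_comm (K (s ω)) (rbin V _)]
    rw [e1]
    calc _ ≤ expect P (fun ω => (expect (K (s ω)) fun v =>
          c ω v + (ind (r (t ω) v ≤ l) + 1 / (F * M * l))) +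
          (2 * expect (K (s ω)) (fun v => ind (τ < K (s ω) v)) + Real.sqrt ((F - 1) * τ))) := by
          refine expect_mono hP fun ω => add_le_add (expect_mono (hK _) fun v =>
            add_le_add le_rfl ?_) ?_
          · exact expect_decTh_err hF hM hl (hr0 _) (hr1 _) v
          · exact expect_binDev_le hF (hK _) hτ
      _ = _ := by
          simp only [expect_add, expect_const (hK _), expect_const hP, expect_const_mul]
          ring
  obtain ⟨f, h⟩ := exists_le_expect hf main
  obtain ⟨m, h⟩ := exists_le_expect hm h
  obtain ⟨i, h⟩ := exists_le_expect (unifF_isPMF hF) h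
  obtain ⟨e, he⟩ := exists_fun_le P s (fun s => condBin (K s) f i)
    (fun s => condBin_isPMF (hK s) f i) (fun ω v => c ω (decTh l (r (t ω)) f m i (m v)))
  exact ⟨m, e, fun t j => decTh l (r t) f m i j, he.trans h⟩

end OneShot

section BT

/-- Joint threshold decoder. -/
def decBT {U V : Type*} [Nonempty U] [Nonempty V] {F₁ M₁ F₂ M₂ : ℕ} (l₁ l₂ l₃ : ℝ)
    (r₁ : V → U → ℝ) (r₂ : U → V → ℝ) (r₃ : U × V → ℝ)
    (f₁ : U → Fin F₁) (m₁ : U → Fin M₁) (f₂ : V → Fin F₂) (m₂ : V → Fin M₂)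
    (i₁ : Fin F₁) (j₁ : Fin M₁) (i₂ : Fin F₂) (j₂ : Fin M₂) : U × V :=
  Classical.epsilon fun p => (l₁ < r₁ p.2 p.1 ∧ l₂ < r₂ p.1 p.2 ∧ l₃ < r₃ p) ∧
    (f₁ p.1 = i₁ ∧ m₁ p.1 = j₁) ∧ (f₂ p.2 = i₂ ∧ m₂ p.2 = j₂)

lemma coll_eq_one {V : Type*} {F M : ℕ} {v v' : V} {f : V → Fin F} {m : V → Fin M}
    (h : v' ≠ v) (hf : f v' = f v) (hm : m v' = m v) : coll v v' f m = 1 := by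
  rw [coll, ind_true h, ind_true hf, ind_true hm]; norm_num

lemma decBT_err {U V : Type*} [Fintype U] [Fintype V] [Nonempty U] [Nonempty V]
    {F₁ M₁ F₂ M₂ : ℕ} (l₁ l₂ l₃ : ℝ)
    (r₁ : V → U → ℝ) (r₂ : U → V → ℝ) (r₃ : U × V → ℝ)
    (f₁ : U → Fin F₁) (m₁ : U → Fin M₁) (f₂ : V → Fin F₂) (m₂ : V → Fin M₂) (u : U) (v : V) :
    ind (decBT l₁ l₂ l₃ r₁ r₂ r₃ f₁ m₁ f₂ m₂ (f₁ u) (m₁ u) (f₂ v) (m₂ v) ≠ (u, v)) ≤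
      (ind (r₁ v u ≤ l₁) + ind (r₂ u v ≤ l₂) + ind (r₃ (u, v) ≤ l₃)) +
      (∑ u', ind (l₁ < r₁ v u') * coll u u' f₁ m₁) +
      (∑ v', ind (l₂ < r₂ u v') * coll v v' f₂ m₂) +
      ∑ p : U × V, ind (l₃ < r₃ p) * (coll u p.1 f₁ m₁ * coll v p.2 f₂ m₂) := by
  have hn1 : ∀ u', 0 ≤ ind (l₁ < r₁ v u') * coll u u' f₁ m₁ :=
    fun u' => mul_nonneg (ind_nonneg _) (coll_nonneg _ _ _ _)
  have hn2 : ∀ v', 0 ≤ ind (l₂ < r₂ u v') * coll v v' f₂ m₂ :=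
    fun u' => mul_nonneg (ind_nonneg _) (coll_nonneg _ _ _ _)
  have hn3 : ∀ p : U × V, 0 ≤ ind (l₃ < r₃ p) * (coll u p.1 f₁ m₁ * coll v p.2 f₂ m₂) :=
    fun p => mul_nonneg (ind_nonneg _) (mul_nonneg (coll_nonneg _ _ _ _) (coll_nonneg _ _ _ _))
  have s1 := Finset.sum_nonneg fun v' (_ : v' ∈ Finset.univ) => hn1 v'
  have s2 := Finset.sum_nonneg fun v' (_ : v' ∈ Finset.univ) => hn2 v'
  have s3 := Finset.sum_nonneg fun v' (_ : v' ∈ Finset.univ) => hn3 v'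
  have a1 := ind_nonneg (r₁ v u ≤ l₁)
  have a2 := ind_nonneg (r₂ u v ≤ l₂)
  have a3 := ind_nonneg (r₃ (u, v) ≤ l₃)
  by_cases hty : l₁ < r₁ v u ∧ l₂ < r₂ u v ∧ l₃ < r₃ (u, v)
  · obtain ⟨⟨t1, t2, t3⟩, ⟨b1, b2⟩, b3, b4⟩ := Classical.epsilon_spec
      (p := fun p : U × V => (l₁ < r₁ p.2 p.1 ∧ l₂ < r₂ p.1 p.2 ∧ l₃ < r₃ p) ∧
        (f₁ p.1 = f₁ u ∧ m₁ p.1 = m₁ u) ∧ (f₂ p.2 = f₂ v ∧ m₂ p.2 = m₂ v))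
      ⟨(u, v), hty, ⟨rfl, rfl⟩, rfl, rfl⟩
    change l₁ < r₁ (decBT l₁ l₂ l₃ r₁ r₂ r₃ f₁ m₁ f₂ m₂ (f₁ u) (m₁ u) (f₂ v) (m₂ v)).2
      (decBT l₁ l₂ l₃ r₁ r₂ r₃ f₁ m₁ f₂ m₂ (f₁ u) (m₁ u) (f₂ v) (m₂ v)).1 at t1
    change l₂ < r₂ (decBT l₁ l₂ l₃ r₁ r₂ r₃ f₁ m₁ f₂ m₂ (f₁ u) (m₁ u) (f₂ v) (m₂ v)).1
      (decBT l₁ l₂ l₃ r₁ r₂ r₃ f₁ m₁ f₂ m₂ (f₁ u) (m₁ u) (f₂ v) (m₂ v)).2 at t2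
    change l₃ < r₃ (decBT l₁ l₂ l₃ r₁ r₂ r₃ f₁ m₁ f₂ m₂ (f₁ u) (m₁ u) (f₂ v) (m₂ v)) at t3
    change f₁ (decBT l₁ l₂ l₃ r₁ r₂ r₃ f₁ m₁ f₂ m₂ (f₁ u) (m₁ u) (f₂ v) (m₂ v)).1 = f₁ u at b1
    change m₁ (decBT l₁ l₂ l₃ r₁ r₂ r₃ f₁ m₁ f₂ m₂ (f₁ u) (m₁ u) (f₂ v) (m₂ v)).1 = m₁ u at b2
    change f₂ (decBT l₁ l₂ l₃ r₁ r₂ r₃ f₁ m₁ f₂ m₂ (f₁ u) (m₁ u) (f₂ v) (m₂ v)).2 = f₂ v at b3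
    change m₂ (decBT l₁ l₂ l₃ r₁ r₂ r₃ f₁ m₁ f₂ m₂ (f₁ u) (m₁ u) (f₂ v) (m₂ v)).2 = m₂ v at b4
    generalize decBT l₁ l₂ l₃ r₁ r₂ r₃ f₁ m₁ f₂ m₂ (f₁ u) (m₁ u) (f₂ v) (m₂ v) = q at *
    obtain ⟨a, b⟩ := q
    simp only at t1 t2 t3 b1 b2 b3 b4
    have g1 := Finset.single_le_sum (fun v' _ => hn1 v') (Finset.mem_univ a)
    have g2 := Finset.single_le_sum (fun v' _ => hn2 v') (Finset.mem_univ b)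
    have g3 := Finset.single_le_sum (fun v' _ => hn3 v') (Finset.mem_univ (a, b))
    have i1 := ind_le_one ((a, b) ≠ (u, v))
    by_cases ha : a = u
    · by_cases hb : b = v
      · rw [ind_false (by simp [ha, hb])]; linarith
      · rw [coll_eq_one hb b3 b4, ind_true (by rw [← ha]; exact t2)] at g2
        linarith
    · by_cases hb : b = v
      · rw [coll_eq_one ha b1 b2, ind_true (by rw [← hb]; exact t1)] at g1
        linarith
      · simp only at g3
        rw [coll_eq_one ha b1 b2, coll_eq_one hb b3 b4, ind_true t3] at g3
        linarith
  · have i1 := ind_le_one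
      (decBT l₁ l₂ l₃ r₁ r₂ r₃ f₁ m₁ f₂ m₂ (f₁ u) (m₁ u) (f₂ v) (m₂ v) ≠ (u, v))
    by_cases h1 : l₁ < r₁ v u
    · by_cases h2 : l₂ < r₂ u v
      · by_cases h3 : l₃ < r₃ (u, v)
        · exact absurd ⟨h1, h2, h3⟩ hty
        · have := ind_true (not_lt.1 h3)
          linarith
      · have := ind_true (not_lt.1 h2)
        linarith
    · have := ind_true (not_lt.1 h1)
      linarith

lemma expect_mul_const {Ω : Type*} [Fintype Ω] (μ : Ω → ℝ) (a : ℝ) (g : Ω → ℝ) :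
    expect μ (fun ω => g ω * a) = expect μ g * a := by
  simp only [mul_comm _ a, expect_const_mul]

lemma expect_decBT_err {U V : Type*} [Fintype U] [Fintype V] [Nonempty U] [Nonempty V]
    {F₁ M₁ F₂ M₂ : ℕ} (hF₁ : 0 < F₁) (hM₁ : 0 < M₁) (hF₂ : 0 < F₂) (hM₂ : 0 < M₂)
    {l₁ l₂ l₃ : ℝ} (hl₁ : 0 < l₁) (hl₂ : 0 < l₂) (hl₃ : 0 < l₃)
    {r₁ : V → U → ℝ} {r₂ : U → V → ℝ} {r₃ : U × V → ℝ}
    (hr₁ : ∀ v u, 0 ≤ r₁ v u) (hr₁' : ∀ v, ∑ u, r₁ v u ≤ 1)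
    (hr₂ : ∀ u v, 0 ≤ r₂ u v) (hr₂' : ∀ u, ∑ v, r₂ u v ≤ 1)
    (hr₃ : ∀ p, 0 ≤ r₃ p) (hr₃' : ∑ p, r₃ p ≤ 1) (u : U) (v : V) :
    expect (rbin U F₁) (fun f₁ => expect (rbin U M₁) fun m₁ =>
      expect (rbin V F₂) fun f₂ => expect (rbin V M₂) fun m₂ =>
      ind (decBT l₁ l₂ l₃ r₁ r₂ r₃ f₁ m₁ f₂ m₂ (f₁ u) (m₁ u) (f₂ v) (m₂ v) ≠ (u, v))) ≤
    (ind (r₁ v u ≤ l₁) + ind (r₂ u v ≤ l₂) + ind (r₃ (u, v) ≤ l₃)) +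
      1 / (F₁ * M₁ * l₁) + 1 / (F₂ * M₂ * l₂) + 1 / ((F₁ * M₁) * (F₂ * M₂) * l₃) := by
  have p1 := rbin_isPMF (V := U) hF₁
  have p2 := rbin_isPMF (V := U) hM₁
  have p3 := rbin_isPMF (V := V) hF₂
  have p4 := rbin_isPMF (V := V) hM₂
  refine (expect_mono p1 fun f₁ => expect_mono p2 fun m₁ => expect_mono p3 fun f₂ =>
    expect_mono p4 fun m₂ => decBT_err l₁ l₂ l₃ r₁ r₂ r₃ f₁ m₁ f₂ m₂ u v).trans ?_
  simp only [expect_add, expect_const p1, expect_const p2, expect_const p3, expect_const p4,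
    expect_sum, expect_const_mul, expect_mul_const]
  refine add_le_add (add_le_add (add_le_add le_rfl ?_) ?_) ?_
  · calc _ ≤ ∑ v', ind (l₁ < r₁ v v') * (1 / (F₁ * M₁)) :=
        Finset.sum_le_sum fun v' _ => mul_le_mul_of_nonneg_left (expect_coll hF₁ hM₁ u v')
          (ind_nonneg _)
      _ = (∑ v', ind (l₁ < r₁ v v')) * (1 / (F₁ * M₁)) := by rw [Finset.sum_mul]
      _ ≤ 1 / l₁ * (1 / (F₁ * M₁)) :=
        mul_le_mul_of_nonneg_right (count_le (hr₁ v) (hr₁' v) hl₁) (by positivity)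
      _ = _ := by rw [one_div_mul_one_div, mul_comm l₁]
  · calc _ ≤ ∑ v', ind (l₂ < r₂ u v') * (1 / (F₂ * M₂)) :=
        Finset.sum_le_sum fun v' _ => mul_le_mul_of_nonneg_left (expect_coll hF₂ hM₂ v v')
          (ind_nonneg _)
      _ = (∑ v', ind (l₂ < r₂ u v')) * (1 / (F₂ * M₂)) := by rw [Finset.sum_mul]
      _ ≤ 1 / l₂ * (1 / (F₂ * M₂)) :=
        mul_le_mul_of_nonneg_right (count_le (hr₂ u) (hr₂' u) hl₂) (by positivity)
      _ = _ := by rw [one_div_mul_one_div, mul_comm l₂]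
  · calc _ ≤ ∑ p : U × V, ind (l₃ < r₃ p) * ((1 / (F₁ * M₁)) * (1 / (F₂ * M₂))) :=
        Finset.sum_le_sum fun p _ => mul_le_mul_of_nonneg_left
          (mul_le_mul (expect_coll hF₁ hM₁ u p.1) (expect_coll hF₂ hM₂ v p.2)
            (expect_nonneg p3 fun _ => expect_nonneg p4 fun _ => coll_nonneg _ _ _ _)
            (by positivity)) (ind_nonneg _)
      _ = (∑ p, ind (l₃ < r₃ p)) * ((1 / (F₁ * M₁)) * (1 / (F₂ * M₂))) := by rw [Finset.sum_mul]
      _ ≤ 1 / l₃ * ((1 / (F₁ * M₁)) * (1 / (F₂ * M₂))) :=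
        mul_le_mul_of_nonneg_right (count_le hr₃ hr₃' hl₃) (by positivity)
      _ = _ := by rw [one_div_mul_one_div, one_div_mul_one_div, mul_comm l₃]

/-- One-shot Berger-Tung lemma with side information. -/
lemma oneshot_BT {Ω X Y Z U V : Type*} [Fintype Ω] [Fintype X] [Fintype Y] [Fintype U] [Fintype V]
    [Nonempty U] [Nonempty V]
    {P : Ω → ℝ} (hP : IsPMF P) (x : Ω → X) (y : Ω → Y) (z : Ω → Z)
    {W₁ : X → U → ℝ} (hW₁ : ∀ x, IsPMF (W₁ x)) {W₂ : Y → V → ℝ} (hW₂ : ∀ y, IsPMF (W₂ y))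
    {r₁ : Z → V → U → ℝ} {r₂ : Z → U → V → ℝ} {r₃ : Z → U × V → ℝ}
    (hr₁ : ∀ z v u, 0 ≤ r₁ z v u) (hr₁' : ∀ z v, ∑ u, r₁ z v u ≤ 1)
    (hr₂ : ∀ z u v, 0 ≤ r₂ z u v) (hr₂' : ∀ z u, ∑ v, r₂ z u v ≤ 1)
    (hr₃ : ∀ z p, 0 ≤ r₃ z p) (hr₃' : ∀ z, ∑ p, r₃ z p ≤ 1)
    {c : Ω → U → V → ℝ} (hc0 : ∀ ω u v, 0 ≤ c ω u v) (hc1 : ∀ ω u v, c ω u v ≤ 1)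
    {F₁ M₁ F₂ M₂ : ℕ} (hF₁ : 0 < F₁) (hM₁ : 0 < M₁) (hF₂ : 0 < F₂) (hM₂ : 0 < M₂)
    {l₁ l₂ l₃ τ₁ τ₂ : ℝ} (hl₁ : 0 < l₁) (hl₂ : 0 < l₂) (hl₃ : 0 < l₃)
    (hτ₁ : 0 ≤ τ₁) (hτ₂ : 0 ≤ τ₂) :
    ∃ (m₁ : U → Fin M₁) (m₂ : V → Fin M₂) (e₁ : X → U) (e₂ : Y → V)
      (D : Z → Fin M₁ → Fin M₂ → U × V),
      expect P (fun ω =>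
        if D (z ω) (m₁ (e₁ (x ω))) (m₂ (e₂ (y ω))) = (e₁ (x ω), e₂ (y ω))
          then c ω (e₁ (x ω)) (e₂ (y ω)) else 1) ≤
        expect P (fun ω => expect (W₁ (x ω)) fun u => expect (W₂ (y ω)) fun v =>
          c ω u v + 2 * ind (τ₁ < W₁ (x ω) u) + 2 * ind (τ₂ < W₂ (y ω) v) +
          (ind (r₁ (z ω) v u ≤ l₁) + ind (r₂ (z ω) u v ≤ l₂) + ind (r₃ (z ω) (u, v) ≤ l₃))) +
        (Real.sqrt ((F₁ - 1) * τ₁) + Real.sqrt ((F₂ - 1) * τ₂) +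
          1 / (F₁ * M₁ * l₁) + 1 / (F₂ * M₂ * l₂) + 1 / ((F₁ * M₁) * (F₂ * M₂) * l₃)) := by
  have p1 := rbin_isPMF (V := U) hF₁
  have p2 := rbin_isPMF (V := U) hM₁
  have p3 := rbin_isPMF (V := V) hF₂
  have p4 := rbin_isPMF (V := V) hM₂
  set cc : (U → Fin F₁) → (U → Fin M₁) → (V → Fin F₂) → (V → Fin M₂) → Fin F₁ → Fin F₂ →
      Ω → U → V → ℝ := fun f₁ m₁ f₂ m₂ i₁ i₂ ω u v =>
    if decBT l₁ l₂ l₃ (r₁ (z ω)) (r₂ (z ω)) (r₃ (z ω)) f₁ m₁ f₂ m₂ i₁ (m₁ u) i₂ (m₂ v) = (u, v)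
      then c ω u v else 1 with hcc
  have cc0 : ∀ f₁ m₁ f₂ m₂ i₁ i₂ ω u v, 0 ≤ cc f₁ m₁ f₂ m₂ i₁ i₂ ω u v := by
    intros; simp only [hcc]; split_ifs; exacts [hc0 _ _ _, zero_le_one]
  have cc1 : ∀ f₁ m₁ f₂ m₂ i₁ i₂ ω u v, cc f₁ m₁ f₂ m₂ i₁ i₂ ω u v ≤ 1 := by
    intros; simp only [hcc]; split_ifs; exacts [hc1 _ _ _, le_rfl]
  have main : expect (rbin U F₁) (fun f₁ => expect (rbin U M₁) fun m₁ =>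
      expect (rbin V F₂) fun f₂ => expect (rbin V M₂) fun m₂ =>
      expect (unifF F₁) fun i₁ => expect (unifF F₂) fun i₂ =>
      expect P fun ω => expect (condBin (W₁ (x ω)) f₁ i₁) fun u =>
        expect (condBin (W₂ (y ω)) f₂ i₂) fun v => cc f₁ m₁ f₂ m₂ i₁ i₂ ω u v) ≤
      expect P (fun ω => expect (W₁ (x ω)) fun u => expect (W₂ (y ω)) fun v =>
          c ω u v + 2 * ind (τ₁ < W₁ (x ω) u) + 2 * ind (τ₂ < W₂ (y ω) v) +
          (ind (r₁ (z ω) v u ≤ l₁) + ind (r₂ (z ω) u v ≤ l₂) + ind (r₃ (z ω) (u, v) ≤ l₃))) +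
        (Real.sqrt ((F₁ - 1) * τ₁) + Real.sqrt ((F₂ - 1) * τ₂) +
          1 / (F₁ * M₁ * l₁) + 1 / (F₂ * M₂ * l₂) + 1 / ((F₁ * M₁) * (F₂ * M₂) * l₃)) := by
    have step1 : ∀ f₁ m₁ f₂ m₂, (expect (unifF F₁) fun i₁ => expect (unifF F₂) fun i₂ =>
      expect P fun ω => expect (condBin (W₁ (x ω)) f₁ i₁) fun u =>
        expect (condBin (W₂ (y ω)) f₂ i₂) fun v => cc f₁ m₁ f₂ m₂ i₁ i₂ ω u v) ≤
        expect P fun ω => (expect (W₁ (x ω)) fun u => expect (W₂ (y ω)) fun v =>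
          c ω u v + ind (decBT l₁ l₂ l₃ (r₁ (z ω)) (r₂ (z ω)) (r₃ (z ω)) f₁ m₁ f₂ m₂
            (f₁ u) (m₁ u) (f₂ v) (m₂ v) ≠ (u, v))) +
          binDev (W₁ (x ω)) f₁ + binDev (W₂ (y ω)) f₂ := by
      intro f₁ m₁ f₂ m₂
      have e1 : (expect (unifF F₁) fun i₁ => expect (unifF F₂) fun i₂ =>
        expect P fun ω => expect (condBin (W₁ (x ω)) f₁ i₁) fun u =>
        expect (condBin (W₂ (y ω)) f₂ i₂) fun v => cc f₁ m₁ f₂ m₂ i₁ i₂ ω u v) =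
        expect P fun ω => expect (unifF F₁) fun i₁ => expect (condBin (W₁ (x ω)) f₁ i₁) fun u =>
        expect (unifF F₂) fun i₂ => 
        expect (condBin (W₂ (y ω)) f₂ i₂) fun v => cc f₁ m₁ f₂ m₂ i₁ i₂ ω u v := by
        rw [expect_comm P]
        congr 1; funext i₁
        rw [expect_comm]
        congr 1; funext ω
        rw [expect_comm]
      rw [e1]
      refine expect_mono hP fun ω => ?_
      calc _ ≤ expect (unifF F₁) (fun i₁ => expect (condBin (W₁ (x ω)) f₁ i₁) fun u =>
            (expect (W₂ (y ω)) fun v => cc f₁ m₁ f₂ m₂ i₁ (f₂ v) ω u v) +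
              binDev (W₂ (y ω)) f₂) := by
            refine expect_mono (unifF_isPMF hF₁) fun i₁ =>
              expect_mono (condBin_isPMF (hW₁ _) _ _) fun u => ?_
            exact replace_le (hW₂ (y ω)) f₂ (fun i₂ v => cc f₁ m₁ f₂ m₂ i₁ i₂ ω u v)
              (fun _ _ => cc0 _ _ _ _ _ _ _ _ _) (fun _ _ => cc1 _ _ _ _ _ _ _ _ _)
        _ = expect (unifF F₁) (fun i₁ => expect (condBin (W₁ (x ω)) f₁ i₁) fun u =>
            (expect (W₂ (y ω)) fun v => cc f₁ m₁ f₂ m₂ i₁ (f₂ v) ω u v)) +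
              binDev (W₂ (y ω)) f₂ := by
            simp only [expect_add, expect_const (condBin_isPMF (hW₁ _) _ _),
              expect_const (unifF_isPMF hF₁)]
        _ ≤ _ := by
            refine add_le_add ?_ le_rfl
            refine (replace_le (hW₁ (x ω)) f₁ (fun i₁ u => expect (W₂ (y ω)) fun v =>
              cc f₁ m₁ f₂ m₂ i₁ (f₂ v) ω u v)
              (fun _ _ => expect_nonneg (hW₂ _) fun _ => cc0 _ _ _ _ _ _ _ _ _)
              (fun _ _ => expect_le_const (hW₂ _) fun _ => cc1 _ _ _ _ _ _ _ _ _)).trans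
              (add_le_add ?_ le_rfl)
            refine expect_mono (hW₁ _) fun u => expect_mono (hW₂ _) fun v => ?_
            simp only [hcc]
            split_ifs with h
            · linarith [ind_nonneg (decBT l₁ l₂ l₃ (r₁ (z ω)) (r₂ (z ω)) (r₃ (z ω)) f₁ m₁ f₂ m₂
                (f₁ u) (m₁ u) (f₂ v) (m₂ v) ≠ (u, v))]
            · rw [ind_true h]; linarith [hc0 ω u v]
    refine (expect_mono p1 fun f₁ => expect_mono p2 fun m₁ => expect_mono p3 fun f₂ =>
      expect_mono p4 fun m₂ => step1 f₁ m₁ f₂ m₂).trans ?_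
    have e2 : (expect (rbin U F₁) fun f₁ => expect (rbin U M₁) fun m₁ =>
      expect (rbin V F₂) fun f₂ => expect (rbin V M₂) fun m₂ =>
        expect P fun ω => (expect (W₁ (x ω)) fun u => expect (W₂ (y ω)) fun v =>
          c ω u v + ind (decBT l₁ l₂ l₃ (r₁ (z ω)) (r₂ (z ω)) (r₃ (z ω)) f₁ m₁ f₂ m₂
            (f₁ u) (m₁ u) (f₂ v) (m₂ v) ≠ (u, v))) +
          binDev (W₁ (x ω)) f₁ + binDev (W₂ (y ω)) f₂) =
        expect P fun ω => (expect (W₁ (x ω)) fun u => expect (W₂ (y ω)) fun v =>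
          c ω u v + expect (rbin U F₁) fun f₁ => expect (rbin U M₁) fun m₁ =>
            expect (rbin V F₂) fun f₂ => expect (rbin V M₂) fun m₂ =>
            ind (decBT l₁ l₂ l₃ (r₁ (z ω)) (r₂ (z ω)) (r₃ (z ω)) f₁ m₁ f₂ m₂
            (f₁ u) (m₁ u) (f₂ v) (m₂ v) ≠ (u, v))) +
          (expect (rbin U F₁) fun f₁ => binDev (W₁ (x ω)) f₁) +
          (expect (rbin V F₂) fun f₂ => binDev (W₂ (y ω)) f₂) := by
      simp only [expect_comm (rbin U _) P, expect_comm (rbin V _) P]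
      congr 1; funext ω
      simp only [expect_comm (rbin U _) (W₁ (x ω)), expect_comm (rbin V _) (W₁ (x ω)),
        expect_comm (rbin U _) (W₂ (y ω)), expect_comm (rbin V _) (W₂ (y ω)),
        expect_add, expect_const p1, expect_const p2, expect_const p3, expect_const p4]
    rw [e2]
    calc _ ≤ expect P (fun ω => (expect (W₁ (x ω)) fun u => expect (W₂ (y ω)) fun v =>
          c ω u v + ((ind (r₁ (z ω) v u ≤ l₁) + ind (r₂ (z ω) u v ≤ l₂) +
            ind (r₃ (z ω) (u, v) ≤ l₃)) +
            1 / (F₁ * M₁ * l₁) + 1 / (F₂ * M₂ * l₂) + 1 / ((F₁ * M₁) * (F₂ * M₂) * l₃))) +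
          (2 * expect (W₁ (x ω)) (fun v => ind (τ₁ < W₁ (x ω) v)) + Real.sqrt ((F₁ - 1) * τ₁)) +
          (2 * expect (W₂ (y ω)) (fun v => ind (τ₂ < W₂ (y ω) v)) +
            Real.sqrt ((F₂ - 1) * τ₂))) := by
          refine expect_mono hP fun ω => add_le_add (add_le_add (expect_mono (hW₁ _) fun u =>
            expect_mono (hW₂ _) fun v => add_le_add le_rfl ?_) ?_) ?_
          · exact expect_decBT_err hF₁ hM₁ hF₂ hM₂ hl₁ hl₂ hl₃ (hr₁ _) (hr₁' _) (hr₂ _) (hr₂' _)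
              (hr₃ _) (hr₃' _) u v
          · exact expect_binDev_le hF₁ (hW₁ _) hτ₁
          · exact expect_binDev_le hF₂ (hW₂ _) hτ₂
      _ = _ := by
          simp only [expect_add, expect_const (hW₁ _), expect_const (hW₂ _), expect_const hP,
            expect_const_mul]
          ring
  obtain ⟨f₁, h⟩ := exists_le_expect p1 main
  obtain ⟨m₁, h⟩ := exists_le_expect p2 h
  obtain ⟨f₂, h⟩ := exists_le_expect p3 h
  obtain ⟨m₂, h⟩ := exists_le_expect p4 h
  obtain ⟨i₁, h⟩ := exists_le_expect (unifF_isPMF hF₁) h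
  obtain ⟨i₂, h⟩ := exists_le_expect (unifF_isPMF hF₂) h
  obtain ⟨e₁, he₁⟩ := exists_fun_le P x (fun a => condBin (W₁ a) f₁ i₁)
    (fun a => condBin_isPMF (hW₁ a) f₁ i₁) (fun ω u =>
      expect (condBin (W₂ (y ω)) f₂ i₂) fun v => cc f₁ m₁ f₂ m₂ i₁ i₂ ω u v)
  obtain ⟨e₂, he₂⟩ := exists_fun_le P y (fun a => condBin (W₂ a) f₂ i₂)
    (fun a => condBin_isPMF (hW₂ a) f₂ i₂) (fun ω v => cc f₁ m₁ f₂ m₂ i₁ i₂ ω (e₁ (x ω)) v)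
  exact ⟨m₁, m₂, e₁, e₂, fun z j₁ j₂ => decBT l₁ l₂ l₃ (r₁ z) (r₂ z) (r₃ z) f₁ m₁ f₂ m₂ i₁ j₁ i₂ j₂,
    (he₂.trans he₁).trans h⟩

end BT

section LLN

open Filter Topology

set_option linter.unusedSectionVars false

variable {A : Type*} [Fintype A]

lemma wlln {ν : A → ℝ} (hν : IsPMF ν) (g : A → ℝ) {δ η : ℝ} (hδ : 0 < δ) (hη : 0 < η) :
    ∀ᶠ n : ℕ in atTop, expect (prodW (Fin n) ν)
      (fun w => ind ((n : ℝ) * (expect ν g + δ) ≤ ∑ i, g (w i))) ≤ η := by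
  set m := expect ν g with hm
  set s := expect ν (fun x => (g x - m) ^ 2) with hs
  have hs0 : 0 ≤ s := expect_nonneg hν fun _ => sq_nonneg _
  have hlim : Tendsto (fun n : ℕ => s / δ ^ 2 / (n : ℝ)) atTop (𝓝 0) :=
    tendsto_const_div_atTop_nhds_zero_nat _
  filter_upwards [hlim.eventually (gt_mem_nhds hη), eventually_gt_atTop 0] with n hn hn0
  have hn0' : (0 : ℝ) < n := by exact_mod_cast hn0
  have hmean : expect ν (fun x => g x - m) = 0 := by
    rw [expect_sub, expect_const hν, ← hm, sub_self]
  have h2 := expect_prodW_sq (I := Fin n) hν (fun _ => (1 : ℝ)) (fun x => g x - m) hmean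
  refine le_trans ?_ hn.le
  calc _ ≤ expect (prodW (Fin n) ν)
        (fun w => 1 / (n * δ) ^ 2 * (∑ i, (1 : ℝ) * (g (w i) - m)) ^ 2) := by
        refine expect_mono (prodW_isPMF hν) fun w => ?_
        by_cases h : (n : ℝ) * (m + δ) ≤ ∑ i, g (w i)
        · rw [ind_true h]
          have h3 : ∑ i, (1 : ℝ) * (g (w i) - m) = ∑ i, g (w i) - n * m := by
            simp [Finset.sum_sub_distrib]
          rw [h3, one_div_mul_eq_div, le_div_iff₀ (by positivity), one_mul]
          apply pow_le_pow_left₀ (by positivity)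
          linarith
        · rw [ind_false h]; positivity
    _ = 1 / (n * δ) ^ 2 * (n * s) := by
        rw [expect_const_mul, h2]; simp [hs]
    _ = _ := by field_simp

lemma logb_prod_pos {I : Type*} [Fintype I] {κ : A → ℝ} (w : I → A) (hw : ∀ i, 0 < κ (w i)) :
    (2 : ℝ) ^ (-(∑ i, -Real.logb 2 (κ (w i)))) = ∏ i, κ (w i) := by
  have : -(∑ i, -Real.logb 2 (κ (w i))) = ∑ i, Real.logb 2 (κ (w i)) := by simp
  rw [this, Real.rpow_sum_of_pos (by norm_num)]
  exact Finset.prod_congr rfl fun i _ => Real.rpow_logb (by norm_num) (by norm_num) (hw i)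

lemma prodW_pos {I : Type*} [Fintype I] {ν : A → ℝ} (hν : IsPMF ν) {w : I → A}
    (h : 0 < prodW I ν w) (i : I) : 0 < ν (w i) := by
  refine lt_of_le_of_ne (hν.1 _) fun h0 => ?_
  have : prodW I ν w = 0 := Finset.prod_eq_zero (Finset.mem_univ i) h0.symm
  linarith

lemma aep_lo {ν : A → ℝ} (hν : IsPMF ν) {κ : A → ℝ} (hκ : ∀ a, 0 < ν a → 0 < κ a)
    {δ η : ℝ} (hδ : 0 < δ) (hη : 0 < η) :
    ∀ᶠ n : ℕ in atTop, expect (prodW (Fin n) ν)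
      (fun w => ind (∏ i, κ (w i) ≤
        (2 : ℝ) ^ (-((n : ℝ) * (expect ν (fun a => -Real.logb 2 (κ a)) + δ))))) ≤ η := by
  filter_upwards [wlln hν (fun a => -Real.logb 2 (κ a)) hδ hη] with n hn
  refine le_trans (expect_mono' (prodW_isPMF hν).1 fun w hw => ind_mono fun h => ?_) hn
  rw [← logb_prod_pos w fun i => hκ _ (prodW_pos hν hw i),
    Real.rpow_le_rpow_left_iff (by norm_num)] at h
  linarith

lemma aep_hi {ν : A → ℝ} (hν : IsPMF ν) {κ : A → ℝ} (hκ : ∀ a, 0 < ν a → 0 < κ a)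
    {δ η : ℝ} (hδ : 0 < δ) (hη : 0 < η) :
    ∀ᶠ n : ℕ in atTop, expect (prodW (Fin n) ν)
      (fun w => ind ((2 : ℝ) ^ (-((n : ℝ) * (expect ν (fun a => -Real.logb 2 (κ a)) - δ))) <
        ∏ i, κ (w i))) ≤ η := by
  filter_upwards [wlln hν (fun a => Real.logb 2 (κ a)) hδ hη] with n hn
  refine le_trans (expect_mono' (prodW_isPMF hν).1 fun w hw => ind_mono fun h => ?_) hn
  rw [← logb_prod_pos w fun i => hκ _ (prodW_pos hν hw i),
    Real.rpow_lt_rpow_left_iff (by norm_num), expect_neg] at h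
  rw [Finset.sum_neg_distrib] at h
  linarith

lemma gibbs {ν : A → ℝ} (hν : IsPMF ν) {r W : A → ℝ} (hr : ∀ a, 0 < ν a → 0 < r a)
    (hW : ∀ a, 0 < ν a → 0 < W a) (h : expect ν (fun a => r a / W a) ≤ 1) :
    expect ν (fun a => -Real.logb 2 (W a)) ≤ expect ν (fun a => -Real.logb 2 (r a)) := by
  have hl : 0 < Real.log 2 := Real.log_pos (by norm_num)
  have h1 : expect ν (fun a => -Real.logb 2 (W a)) - expect ν (fun a => -Real.logb 2 (r a)) ≤
      expect ν (fun a => 1 / Real.log 2 * (r a / W a - 1)) := by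
    rw [← expect_sub]
    refine expect_mono' hν.1 fun a ha => ?_
    have hra := hr a ha
    have hWa := hW a ha
    have := Real.log_le_sub_one_of_pos (div_pos hra hWa)
    rw [Real.log_div hra.ne' hWa.ne'] at this
    simp only [Real.logb]
    calc _ = 1 / Real.log 2 * (Real.log (r a) - Real.log (W a)) := by ring
      _ ≤ _ := mul_le_mul_of_nonneg_left this (by positivity)
  rw [expect_const_mul, expect_sub, expect_const hν] at h1
  have : 1 / Real.log 2 * (expect ν (fun a => r a / W a) - 1) ≤ 0 :=
    mul_nonpos_of_nonneg_of_nonpos (by positivity) (by linarith)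
  linarith

lemma tendsto_two_pow {δ : ℝ} (hδ : 0 < δ) :
    Tendsto (fun n : ℕ => (2 : ℝ) ^ (-((n : ℝ) * δ))) atTop (𝓝 0) := by
  have h : (fun n : ℕ => (2 : ℝ) ^ (-((n : ℝ) * δ))) = fun n : ℕ => ((2 : ℝ) ^ (-δ)) ^ n := by
    funext n
    rw [← Real.rpow_natCast, ← Real.rpow_mul (by norm_num)]
    ring_nf
  rw [h]
  apply tendsto_pow_atTop_nhds_zero_of_lt_one (by positivity)
  exact Real.rpow_lt_one_of_one_lt_of_neg (by norm_num) (by linarith)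

/-- number of public bins -/
def nbF (n : ℕ) (h δ : ℝ) : ℕ := ⌈(2 : ℝ) ^ ((n : ℝ) * (h - 2 * δ))⌉₊
/-- number of messages -/
def nbM (n : ℕ) (R : ℝ) : ℕ := ⌊(2 : ℝ) ^ ((n : ℝ) * R)⌋₊

lemma nbF_pos (n : ℕ) (h δ : ℝ) : 0 < nbF n h δ := Nat.ceil_pos.2 (by positivity)
lemma nbF_ge (n : ℕ) (h δ : ℝ) : (2 : ℝ) ^ ((n : ℝ) * (h - 2 * δ)) ≤ nbF n h δ := Nat.le_ceil _

lemma nbF_sqrt_le (n : ℕ) (h δ : ℝ) :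
    Real.sqrt ((nbF n h δ - 1) * (2 : ℝ) ^ (-((n : ℝ) * (h - δ)))) ≤
      (2 : ℝ) ^ (-((n : ℝ) * (δ / 2))) := by
  apply Real.sqrt_le_iff.2
  refine ⟨by positivity, ?_⟩
  have h1 : (nbF n h δ : ℝ) - 1 ≤ (2 : ℝ) ^ ((n : ℝ) * (h - 2 * δ)) := by
    have := Nat.ceil_lt_add_one (a := (2 : ℝ) ^ ((n : ℝ) * (h - 2 * δ))) (by positivity)
    unfold nbF; linarith
  calc _ ≤ (2 : ℝ) ^ ((n : ℝ) * (h - 2 * δ)) * (2 : ℝ) ^ (-((n : ℝ) * (h - δ))) :=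
        mul_le_mul_of_nonneg_right h1 (by positivity)
    _ = _ := by
        rw [← Real.rpow_add (by norm_num), ← Real.rpow_natCast, ← Real.rpow_mul (by norm_num)]
        congr 1; push_cast; ring

lemma nbM_le (n : ℕ) (R : ℝ) : (nbM n R : ℝ) ≤ (2 : ℝ) ^ ((n : ℝ) * R) :=
  Nat.floor_le (by positivity)

lemma nbM_pos (n : ℕ) {R : ℝ} (hR : 0 ≤ R) : 0 < nbM n R :=
  Nat.floor_pos.2 (Real.one_le_rpow (by norm_num) (by positivity))

lemma nbM_ge (n : ℕ) {R : ℝ} (hR : 0 ≤ R) : (2 : ℝ) ^ ((n : ℝ) * R) ≤ 2 * nbM n R := by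
  have h1 := Nat.lt_floor_add_one ((2 : ℝ) ^ ((n : ℝ) * R))
  have h2 : (1 : ℝ) ≤ nbM n R := by exact_mod_cast nbM_pos n hR
  have h3 : (nbM n R : ℝ) = (⌊(2 : ℝ) ^ ((n : ℝ) * R)⌋₊ : ℝ) := rfl
  linarith

lemma nbFM_ge (n : ℕ) {R : ℝ} (hR : 0 ≤ R) (h δ : ℝ) :
    (2 : ℝ) ^ ((n : ℝ) * (h - 2 * δ + R)) ≤ 2 * (nbF n h δ * nbM n R) := by
  calc _ = (2 : ℝ) ^ ((n : ℝ) * (h - 2 * δ)) * (2 : ℝ) ^ ((n : ℝ) * R) := by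
        rw [← Real.rpow_add (by norm_num)]; congr 1; ring
    _ ≤ nbF n h δ * (2 * nbM n R) :=
        mul_le_mul (nbF_ge n h δ) (nbM_ge n hR) (by positivity) (by positivity)
    _ = _ := by ring

lemma inv_bound {n : ℕ} {B C a b δ : ℝ} (hC : 0 < C) (hB : (2 : ℝ) ^ ((n : ℝ) * a) ≤ C * B)
    (hab : b + δ ≤ a) :
    1 / (B * (2 : ℝ) ^ (-((n : ℝ) * b))) ≤ C * (2 : ℝ) ^ (-((n : ℝ) * δ)) := by
  have hpos : (0 : ℝ) < (2 : ℝ) ^ ((n : ℝ) * a) := by positivity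
  have hB0 : 0 < B := by
    by_contra hneg
    have : C * B ≤ 0 := mul_nonpos_of_nonneg_of_nonpos hC.le (not_lt.1 hneg)
    linarith
  rw [div_le_iff₀ (by positivity)]
  calc (1 : ℝ) ≤ (2 : ℝ) ^ ((n : ℝ) * a + -((n : ℝ) * b) + -((n : ℝ) * δ)) := by
        apply Real.one_le_rpow (by norm_num)
        have : (0:ℝ) ≤ n * (a - b - δ) := mul_nonneg (by positivity) (by linarith)
        linarith
    _ = (2 : ℝ) ^ ((n : ℝ) * a) * (2 : ℝ) ^ (-((n : ℝ) * b)) * (2 : ℝ) ^ (-((n : ℝ) * δ)) := by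
        rw [Real.rpow_add (by norm_num), Real.rpow_add (by norm_num)]
    _ ≤ (C * B) * (2 : ℝ) ^ (-((n : ℝ) * b)) * (2 : ℝ) ^ (-((n : ℝ) * δ)) := by gcongr
    _ = _ := by ring

end LLN

section Asymp

open Filter Topology

/-- joint pmf of a pmf and a kernel -/
def jn {A B : Type*} (ν : A → ℝ) (κ : A → B → ℝ) : A × B → ℝ := fun ab => ν ab.1 * κ ab.1 ab.2

lemma jn_isPMF {A B : Type*} [Fintype A] [Fintype B] {ν : A → ℝ} {κ : A → B → ℝ} (hν : IsPMF ν)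
    (hκ : ∀ a, IsPMF (κ a)) : IsPMF (jn ν κ) := kernel_isPMF hν hκ

lemma jn_pos {A B : Type*} [Fintype A] [Fintype B] {ν : A → ℝ} {κ : A → B → ℝ} (hν : IsPMF ν)
    (hκ : ∀ a, IsPMF (κ a)) {ab : A × B} (h : 0 < jn ν κ ab) :
    0 < ν ab.1 ∧ 0 < κ ab.1 ab.2 := by
  have h1 := hν.1 ab.1
  have h2 := (hκ ab.1).1 ab.2
  unfold jn at h
  constructor
  · exact lt_of_le_of_ne h1 fun h0 => by rw [← h0, zero_mul] at h; exact lt_irrefl _ h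
  · exact lt_of_le_of_ne h2 fun h0 => by rw [← h0, mul_zero] at h; exact lt_irrefl _ h

lemma expect_jn {A B : Type*} [Fintype A] [Fintype B] (ν : A → ℝ) (κ : A → B → ℝ)
    (g : A × B → ℝ) : expect (jn ν κ) g = expect ν (fun a => expect (κ a) fun b => g (a, b)) := by
  unfold expect jn
  rw [Fintype.sum_prod_type]
  refine Finset.sum_congr rfl fun a _ => ?_
  rw [Finset.mul_sum]
  exact Finset.sum_congr rfl fun b _ => by ring

lemma expect_ratio_le {B : Type*} [Fintype B] {κ r : B → ℝ} (hκ : IsPMF κ)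
    (hr0 : ∀ b, 0 ≤ r b) (hr1 : ∑ b, r b ≤ 1) : expect κ (fun b => r b / κ b) ≤ 1 := by
  refine le_trans (Finset.sum_le_sum fun b _ => ?_) hr1
  by_cases h : κ b = 0
  · simp [h, hr0 b]
  · rw [mul_div_cancel₀ _ h]

/-- Asymptotic Wyner-Ziv lemma. -/
lemma asymp_WZ {A S T V : Type*} [Fintype A] [Fintype S] [Fintype T] [Fintype V] [Nonempty V]
    {π : A → ℝ} (hπ : IsPMF π) (s : A → S) (t : A → T)
    {K : S → V → ℝ} (hK : ∀ s, IsPMF (K s))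
    {r : T → V → ℝ} (hr0 : ∀ t v, 0 ≤ r t v) (hr1 : ∀ t, ∑ v, r t v ≤ 1)
    (hpos : ∀ a v, 0 < π a → 0 < K (s a) v → 0 < r (t a) v)
    {R ε η : ℝ} (hε : 0 < ε) (hη : 0 < η)
    (hR : expect (jn π fun a => K (s a)) (fun p => -Real.logb 2 (r (t p.1) p.2)) -
      expect (jn π fun a => K (s a)) (fun p => -Real.logb 2 (K (s p.1) p.2)) ≤ R) :
    ∀ᶠ n : ℕ in atTop, ∃ M : ℕ, (M : ℝ) ≤ (2 : ℝ) ^ ((n : ℝ) * (R + ε)) ∧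
      ∀ c : (Fin n → A) → (Fin n → V) → ℝ, (∀ w v, 0 ≤ c w v) → (∀ w v, c w v ≤ 1) →
      ∃ (k : (Fin n → V) → Fin M) (e : (Fin n → S) → (Fin n → V))
        (d : (Fin n → T) → Fin M → (Fin n → V)),
        expect (prodW (Fin n) π)
          (fun w => c w (d (fun i => t (w i)) (k (e fun i => s (w i))))) ≤
        expect (prodW (Fin n) (jn π fun a => K (s a)))
          (fun w => c (fun i => (w i).1) (fun i => (w i).2)) + η := by
  set ν := jn π fun a => K (s a) with hνdef
  have hν : IsPMF ν := jn_isPMF hπ fun a => hK (s a)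
  have hνK : ∀ p, 0 < ν p → 0 < K (s p.1) p.2 := fun p hp => (jn_pos hπ (fun a => hK (s a)) hp).2
  have hνr : ∀ p, 0 < ν p → 0 < r (t p.1) p.2 := fun p hp =>
    hpos _ _ (jn_pos hπ (fun a => hK (s a)) hp).1 (hνK p hp)
  have hg := gibbs hν hνr hνK (by
    rw [hνdef, expect_jn]
    exact expect_le_const hπ fun a => expect_ratio_le (r := r (t a)) (hK (s a)) (hr0 _) (hr1 _))
  set h := expect ν (fun p => -Real.logb 2 (K (s p.1) p.2)) with hh
  set g := expect ν (fun p => -Real.logb 2 (r (t p.1) p.2)) with hgg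
  set δ := ε / 8 with hδ
  have hδ0 : 0 < δ := by positivity
  have hRε : 0 ≤ R + ε := by linarith
  have lim1 := (tendsto_two_pow (half_pos hδ0)).eventually (gt_mem_nhds (show 0 < η / 5 by positivity))
  have lim2 := (tendsto_two_pow hδ0).eventually (gt_mem_nhds (show 0 < η / 10 by positivity))
  filter_upwards [lim1, lim2, aep_hi hν hνK hδ0 (show 0 < η / 5 by positivity),
    aep_lo hν hνr hδ0 (show 0 < η / 5 by positivity)] with n l1 l2 a1 a2
  refine ⟨nbM n (R + ε), nbM_le n _, fun c hc0 hc1 => ?_⟩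
  obtain ⟨k, e, d, hmain⟩ := oneshot_WZ (P := prodW (Fin n) π) (prodW_isPMF hπ)
    (s := fun w i => s (w i)) (t := fun w i => t (w i))
    (K := fun (s : Fin n → S) (v : Fin n → V) => ∏ i, K (s i) (v i))
    (prodKernel_isPMF hK)
    (r := fun (t : Fin n → T) (v : Fin n → V) => ∏ i, r (t i) (v i))
    (fun t v => Finset.prod_nonneg fun i _ => hr0 _ _)
    (prodKernel_sub hr0 hr1) hc0 hc1 (nbF_pos n h δ) (nbM_pos n hRε)
    (τ := (2 : ℝ) ^ (-((n : ℝ) * (h - δ)))) (l := (2 : ℝ) ^ (-((n : ℝ) * (g + δ))))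
    (by positivity) (by positivity)
  refine ⟨k, e, d, hmain.trans ?_⟩
  have conv : ∀ G : (Fin n → A) → (Fin n → V) → ℝ, expect (prodW (Fin n) π) (fun w =>
      expect (fun v : Fin n → V => ∏ i, K (s (w i)) (v i)) fun v => G w v) =
      expect (prodW (Fin n) ν) (fun w => G (fun i => (w i).1) (fun i => (w i).2)) := fun G =>
    expect_prodW_kernel π (fun a => K (s a)) G
  rw [conv, conv (fun w v => ind ((2 : ℝ) ^ (-((n : ℝ) * (h - δ))) < ∏ i, K (s (w i)) (v i))),
    conv (fun w v => ind (∏ i, r (t (w i)) (v i) ≤ (2 : ℝ) ^ (-((n : ℝ) * (g + δ)))))]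
  have b1 := nbF_sqrt_le n h δ
  have b2 := inv_bound (n := n) (b := g + δ) (δ := δ) (by norm_num : (0 : ℝ) < 2)
    (nbFM_ge n hRε h δ) (by linarith)
  linarith

/-- Asymptotic Berger-Tung lemma. -/
lemma asymp_BT {A X Y Z U V : Type*} [Fintype A] [Fintype X] [Fintype Y] [Fintype U] [Fintype V]
    [Nonempty U] [Nonempty V]
    {π : A → ℝ} (hπ : IsPMF π) (x : A → X) (y : A → Y) (z : A → Z)
    {W₁ : X → U → ℝ} (hW₁ : ∀ x, IsPMF (W₁ x)) {W₂ : Y → V → ℝ} (hW₂ : ∀ y, IsPMF (W₂ y))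
    {r₁ : Z → V → U → ℝ} {r₂ : Z → U → V → ℝ} {r₃ : Z → U × V → ℝ}
    (hr₁ : ∀ z v u, 0 ≤ r₁ z v u) (hr₁' : ∀ z v, ∑ u, r₁ z v u ≤ 1)
    (hr₂ : ∀ z u v, 0 ≤ r₂ z u v) (hr₂' : ∀ z u, ∑ v, r₂ z u v ≤ 1)
    (hr₃ : ∀ z p, 0 ≤ r₃ z p) (hr₃' : ∀ z, ∑ p, r₃ z p ≤ 1)
    {ν : (A × U) × V → ℝ}
    (hνdef : ν = jn (jn π fun a => W₁ (x a)) fun p => W₂ (y p.1))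
    (hp₁ : ∀ p, 0 < ν p → 0 < r₁ (z p.1.1) p.2 p.1.2)
    (hp₂ : ∀ p, 0 < ν p → 0 < r₂ (z p.1.1) p.1.2 p.2)
    (hp₃ : ∀ p, 0 < ν p → 0 < r₃ (z p.1.1) (p.1.2, p.2))
    {R₁ R₂ ε η : ℝ} (hε : 0 < ε) (hη : 0 < η)
    (hR₁ : expect ν (fun p => -Real.logb 2 (r₁ (z p.1.1) p.2 p.1.2)) -
      expect ν (fun p => -Real.logb 2 (W₁ (x p.1.1) p.1.2)) ≤ R₁)
    (hR₂ : expect ν (fun p => -Real.logb 2 (r₂ (z p.1.1) p.1.2 p.2)) -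
      expect ν (fun p => -Real.logb 2 (W₂ (y p.1.1) p.2)) ≤ R₂)
    (hR₃ : expect ν (fun p => -Real.logb 2 (r₃ (z p.1.1) (p.1.2, p.2))) -
      expect ν (fun p => -Real.logb 2 (W₁ (x p.1.1) p.1.2)) -
      expect ν (fun p => -Real.logb 2 (W₂ (y p.1.1) p.2)) ≤ R₁ + R₂) :
    ∀ᶠ n : ℕ in atTop, ∃ M₁ M₂ : ℕ, (M₁ : ℝ) ≤ (2 : ℝ) ^ ((n : ℝ) * (R₁ + ε)) ∧
      (M₂ : ℝ) ≤ (2 : ℝ) ^ ((n : ℝ) * (R₂ + ε)) ∧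
      ∀ c : (Fin n → A) → (Fin n → U) → (Fin n → V) → ℝ, (∀ w u v, 0 ≤ c w u v) →
        (∀ w u v, c w u v ≤ 1) →
      ∃ (m₁ : (Fin n → U) → Fin M₁) (m₂ : (Fin n → V) → Fin M₂)
        (e₁ : (Fin n → X) → (Fin n → U)) (e₂ : (Fin n → Y) → (Fin n → V))
        (D : (Fin n → Z) → Fin M₁ → Fin M₂ → (Fin n → U) × (Fin n → V)),
        expect (prodW (Fin n) π) (fun w =>
          if D (fun i => z (w i)) (m₁ (e₁ fun i => x (w i))) (m₂ (e₂ fun i => y (w i))) =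
            (e₁ (fun i => x (w i)), e₂ (fun i => y (w i)))
          then c w (e₁ fun i => x (w i)) (e₂ fun i => y (w i)) else 1) ≤
        expect (prodW (Fin n) ν)
          (fun w => c (fun i => (w i).1.1) (fun i => (w i).1.2) (fun i => (w i).2)) + η := by
  have hπ1 : IsPMF (jn π fun a => W₁ (x a)) := jn_isPMF hπ fun a => hW₁ (x a)
  have hν : IsPMF ν := by rw [hνdef]; exact jn_isPMF hπ1 fun p => hW₂ (y p.1)
  have hν2 : ∀ p, 0 < ν p → 0 < W₂ (y p.1.1) p.2 := fun p hp =>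
    (jn_pos hπ1 (fun a => hW₂ (y a.1)) (by rw [hνdef] at hp; exact hp)).2
  have hν1 : ∀ p, 0 < ν p → 0 < W₁ (x p.1.1) p.1.2 := fun p hp =>
    (jn_pos hπ (fun a => hW₁ (x a))
      (jn_pos hπ1 (fun a => hW₂ (y a.1)) (by rw [hνdef] at hp; exact hp)).1).2
  have hg1 := gibbs hν hp₁ hν1 (by
    rw [hνdef, expect_jn, expect_jn]
    refine expect_le_const hπ fun a => ?_
    refine (expect_comm (W₁ (x a)) (W₂ (y a))
      (fun u v => r₁ (z a) v u / W₁ (x a) u)).trans_le ?_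
    exact expect_le_const (hW₂ _) fun v =>
      expect_ratio_le (r := r₁ (z a) v) (hW₁ (x a)) (hr₁ _ _) (hr₁' _ _))
  have hg2 := gibbs hν hp₂ hν2 (by
    rw [hνdef, expect_jn]
    exact expect_le_const hπ1 fun a => 
      expect_ratio_le (r := r₂ (z a.1) a.2) (hW₂ (y a.1)) (hr₂ _ _) (hr₂' _ _))
  set h₁ := expect ν (fun p => -Real.logb 2 (W₁ (x p.1.1) p.1.2)) with hh₁
  set h₂ := expect ν (fun p => -Real.logb 2 (W₂ (y p.1.1) p.2)) with hh₂
  set g₁ := expect ν (fun p => -Real.logb 2 (r₁ (z p.1.1) p.2 p.1.2)) with hgg₁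
  set g₂ := expect ν (fun p => -Real.logb 2 (r₂ (z p.1.1) p.1.2 p.2)) with hgg₂
  set g₃ := expect ν (fun p => -Real.logb 2 (r₃ (z p.1.1) (p.1.2, p.2))) with hgg₃
  set δ := ε / 8 with hδ
  have hδ0 : 0 < δ := by positivity
  have hRε₁ : 0 ≤ R₁ + ε := by linarith
  have hRε₂ : 0 ≤ R₂ + ε := by linarith
  have hη' : 0 < η / 40 := by positivity
  have lim1 := (tendsto_two_pow (half_pos hδ0)).eventually (gt_mem_nhds hη')
  have lim2 := (tendsto_two_pow hδ0).eventually (gt_mem_nhds hη')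
  filter_upwards [lim1, lim2, aep_hi hν hν1 hδ0 hη', aep_hi hν hν2 hδ0 hη',
    aep_lo hν hp₁ hδ0 hη', aep_lo hν hp₂ hδ0 hη', aep_lo hν hp₃ hδ0 hη']
    with n l1 l2 a1 a2 a3 a4 a5
  refine ⟨nbM n (R₁ + ε), nbM n (R₂ + ε), nbM_le n _, nbM_le n _, fun c hc0 hc1 => ?_⟩
  obtain ⟨m₁, m₂, e₁, e₂, D, hmain⟩ := oneshot_BT (P := prodW (Fin n) π) (prodW_isPMF hπ)
    (x := fun w i => x (w i)) (y := fun w i => y (w i)) (z := fun w i => z (w i))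
    (W₁ := fun (a : Fin n → X) (u : Fin n → U) => ∏ i, W₁ (a i) (u i)) (prodKernel_isPMF hW₁)
    (W₂ := fun (a : Fin n → Y) (u : Fin n → V) => ∏ i, W₂ (a i) (u i)) (prodKernel_isPMF hW₂)
    (r₁ := fun (z : Fin n → Z) (v : Fin n → V) (u : Fin n → U) => ∏ i, r₁ (z i) (v i) (u i))
    (r₂ := fun (z : Fin n → Z) (u : Fin n → U) (v : Fin n → V) => ∏ i, r₂ (z i) (u i) (v i))
    (r₃ := fun (z : Fin n → Z) (p : (Fin n → U) × (Fin n → V)) => ∏ i, r₃ (z i) (p.1 i, p.2 i))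
    (fun _ _ _ => Finset.prod_nonneg fun i _ => hr₁ _ _ _)
    (fun z v => by
      rw [sum_prod_fun (fun i u => r₁ (z i) (v i) u)]
      exact Finset.prod_le_one (fun i _ => Finset.sum_nonneg fun b _ => hr₁ _ _ _)
        fun i _ => hr₁' _ _)
    (fun _ _ _ => Finset.prod_nonneg fun i _ => hr₂ _ _ _)
    (fun z v => by
      rw [sum_prod_fun (fun i u => r₂ (z i) (v i) u)]
      exact Finset.prod_le_one (fun i _ => Finset.sum_nonneg fun b _ => hr₂ _ _ _)
        fun i _ => hr₂' _ _)
    (fun _ _ => Finset.prod_nonneg fun i _ => hr₃ _ _)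
    (fun z => by
      rw [← (Equiv.arrowProdEquivProdArrow (Fin n) (fun _ => U) (fun _ => V)).sum_comp]
      change ∑ w : Fin n → U × V, ∏ i, r₃ (z i) (w i) ≤ 1
      rw [sum_prod_fun (fun i u => r₃ (z i) u)]
      exact Finset.prod_le_one (fun i _ => Finset.sum_nonneg fun b _ => hr₃ _ _)
        fun i _ => hr₃' _)
    hc0 hc1 (nbF_pos n h₁ δ) (nbM_pos n hRε₁) (nbF_pos n h₂ δ) (nbM_pos n hRε₂)
    (l₁ := (2 : ℝ) ^ (-((n : ℝ) * (g₁ + δ)))) (l₂ := (2 : ℝ) ^ (-((n : ℝ) * (g₂ + δ))))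
    (l₃ := (2 : ℝ) ^ (-((n : ℝ) * (g₃ + δ))))
    (τ₁ := (2 : ℝ) ^ (-((n : ℝ) * (h₁ - δ)))) (τ₂ := (2 : ℝ) ^ (-((n : ℝ) * (h₂ - δ))))
    (by positivity) (by positivity) (by positivity) (by positivity) (by positivity)
  refine ⟨m₁, m₂, e₁, e₂, D, le_trans (le_of_eq ?_) (hmain.trans ?_)⟩
  · congr 1; funext w; congr
  have conv : ∀ G : (Fin n → A) → (Fin n → U) → (Fin n → V) → ℝ,
      expect (prodW (Fin n) π) (fun w =>
      expect (fun u : Fin n → U => ∏ i, W₁ (x (w i)) (u i)) fun u =>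
      expect (fun v : Fin n → V => ∏ i, W₂ (y (w i)) (v i)) fun v => G w u v) =
      expect (prodW (Fin n) ν) (fun w => G (fun i => (w i).1.1) (fun i => (w i).1.2)
        (fun i => (w i).2)) := by
    intro G
    rw [hνdef]
    refine (expect_prodW_kernel π (fun a => W₁ (x a)) (fun w u =>
      expect (fun v : Fin n → V => ∏ i, W₂ (y (w i)) (v i)) fun v => G w u v)).trans ?_
    exact expect_prodW_kernel (jn π fun a => W₁ (x a)) (fun p => W₂ (y p.1)) (fun w v =>
      G (fun i => (w i).1) (fun i => (w i).2) v)
  rw [conv (fun w u v => c w u v + 2 * ind ((2 : ℝ) ^ (-((n : ℝ) * (h₁ - δ))) <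
      ∏ i, W₁ (x (w i)) (u i)) + 2 * ind ((2 : ℝ) ^ (-((n : ℝ) * (h₂ - δ))) <
      ∏ i, W₂ (y (w i)) (v i)) + (ind (∏ i, r₁ (z (w i)) (v i) (u i) ≤
        (2 : ℝ) ^ (-((n : ℝ) * (g₁ + δ)))) + ind (∏ i, r₂ (z (w i)) (u i) (v i) ≤
        (2 : ℝ) ^ (-((n : ℝ) * (g₂ + δ)))) + ind (∏ i, r₃ (z (w i)) (u i, v i) ≤
        (2 : ℝ) ^ (-((n : ℝ) * (g₃ + δ))))))]
  simp only [expect_add, expect_const_mul]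
  have b1 := nbF_sqrt_le n h₁ δ
  have b2 := nbF_sqrt_le n h₂ δ
  have f1 := nbFM_ge n hRε₁ h₁ δ
  have f2 := nbFM_ge n hRε₂ h₂ δ
  have f3 : (2 : ℝ) ^ ((n : ℝ) * ((h₁ - 2 * δ + (R₁ + ε)) + (h₂ - 2 * δ + (R₂ + ε)))) ≤
      4 * ((nbF n h₁ δ * nbM n (R₁ + ε)) * (nbF n h₂ δ * nbM n (R₂ + ε))) := by
    calc _ = (2 : ℝ) ^ ((n : ℝ) * (h₁ - 2 * δ + (R₁ + ε))) *
          (2 : ℝ) ^ ((n : ℝ) * (h₂ - 2 * δ + (R₂ + ε))) := by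
          rw [← Real.rpow_add (by norm_num)]; congr 1; ring
      _ ≤ _ := mul_le_mul f1 f2 (by positivity) (by positivity)
      _ = _ := by ring
  have b3 := inv_bound (n := n) (b := g₁ + δ) (δ := δ) (by norm_num : (0 : ℝ) < 2) f1
    (by linarith)
  have b4 := inv_bound (n := n) (b := g₂ + δ) (δ := δ) (by norm_num : (0 : ℝ) < 2) f2
    (by linarith)
  have b5 := inv_bound (n := n) (b := g₃ + δ) (δ := δ) (by norm_num : (0 : ℝ) < 4) f3
    (by linarith)
  linarith

end Asymp

section Ent

variable {Ω α β γ A B C D : Type*} [Fintype Ω]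

lemma probOf_nonneg {μ : Ω → ℝ} (hμ : ∀ ω, 0 ≤ μ ω) (f : Ω → α) (a : α) : 0 ≤ probOf μ f a :=
  Finset.sum_nonneg fun ω _ => by split_ifs; exacts [hμ ω, le_rfl]

lemma le_probOf {μ : Ω → ℝ} (hμ : ∀ ω, 0 ≤ μ ω) (f : Ω → α) (ω : Ω) : μ ω ≤ probOf μ f (f ω) := by
  have := Finset.single_le_sum (f := fun ω' => if f ω' = f ω then μ ω' else 0)
    (fun ω' _ => by split_ifs; exacts [hμ ω', le_rfl]) (Finset.mem_univ ω)
  simpa [probOf] using this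

lemma exists_of_probOf_pos {μ : Ω → ℝ} (f : Ω → α) {a : α} (h : 0 < probOf μ f a) :
    ∃ ω, f ω = a ∧ 0 < μ ω := by
  by_contra hcon
  push Not at hcon
  refine absurd h (not_lt.2 (Finset.sum_nonpos fun ω _ => ?_))
  split_ifs with hf
  · exact hcon ω hf
  · exact le_rfl

lemma expect_comp [Fintype D] (μ : Ω → ℝ) (T : Ω → D) (F : D → ℝ) :
    expect μ (fun ω => F (T ω)) = expect (probOf μ T) F := by
  unfold expect probOf
  simp only [Finset.sum_mul]
  rw [Finset.sum_comm]
  refine Finset.sum_congr rfl fun ω _ => ?_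
  simp [ite_mul]

lemma entropy_eq [Fintype α] (μ : Ω → ℝ) (f : Ω → α) :
    entropy μ f = expect μ (fun ω => -Real.logb 2 (probOf μ f (f ω))) := by
  rw [expect_comp μ f (fun a => -Real.logb 2 (probOf μ f a))]
  simp [entropy, expect]

/-- conditional probability `P(g = b | h = c)` -/
def condP (μ : Ω → ℝ) (g : Ω → β) (h : Ω → γ) (c : γ) (b : β) : ℝ :=
  probOf μ (fun ω => (g ω, h ω)) (b, c) / probOf μ h c

lemma condP_nonneg {μ : Ω → ℝ} (hμ : ∀ ω, 0 ≤ μ ω) (g : Ω → β) (h : Ω → γ) (c : γ) (b : β) :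
    0 ≤ condP μ g h c b := div_nonneg (probOf_nonneg hμ _ _) (probOf_nonneg hμ _ _)

lemma sum_probOf_pair [Fintype β] (μ : Ω → ℝ) (g : Ω → β) (h : Ω → γ) (c : γ) :
    ∑ b, probOf μ (fun ω => (g ω, h ω)) (b, c) = probOf μ h c := by
  unfold probOf
  rw [Finset.sum_comm]
  refine Finset.sum_congr rfl fun ω _ => ?_
  by_cases hc : h ω = c
  · simp [hc]
  · simp [hc]

lemma condP_sum [Fintype β] (μ : Ω → ℝ) (g : Ω → β) (h : Ω → γ) (c : γ) :
    ∑ b, condP μ g h c b ≤ 1 := by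
  unfold condP
  rw [← Finset.sum_div, sum_probOf_pair]
  exact div_self_le_one _

lemma condP_pos {μ : Ω → ℝ} (hμ : ∀ ω, 0 ≤ μ ω) (g : Ω → β) (h : Ω → γ) {ω : Ω} (hω : 0 < μ ω) :
    0 < condP μ g h (h ω) (g ω) :=
  div_pos (hω.trans_le (le_probOf hμ (fun ω => (g ω, h ω)) ω)) (hω.trans_le (le_probOf hμ h ω))

lemma probOf_push [Fintype D] (μ : Ω → ℝ) (T : Ω → D) (F : D → β) (x : β) :
    probOf μ (fun ω => F (T ω)) x = ∑ d, if F d = x then probOf μ T d else 0 := by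
  have := expect_comp μ T (fun d => if F d = x then 1 else 0)
  simp only [expect, mul_ite, mul_one, mul_zero] at this
  exact this

lemma condMI_eq [Fintype α] [Fintype γ] [Fintype A] [Fintype B]
    {μ : Ω → ℝ} (hμ : ∀ ω, 0 ≤ μ ω) (T : Ω → A × B) (π : A → ℝ) (κ : α → γ → B → ℝ)
    (f : A → α) (h : A → γ) (hT : ∀ d, probOf μ T d = π d.1 * κ (f d.1) (h d.1) d.2)
    (hκ : ∀ a c, ∑ b, κ a c b = 1) :
    condMI μ (fun ω => f (T ω).1) (fun ω => (T ω).2) (fun ω => h (T ω).1) =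
      expect μ (fun ω => -Real.logb 2
        (condP μ (fun ω => (T ω).2) (fun ω => h (T ω).1) (h (T ω).1) (T ω).2)) -
      expect μ (fun ω => -Real.logb 2 (κ (f (T ω).1) (h (T ω).1) (T ω).2)) := by
  have fac : ∀ a b c, probOf μ (fun ω => ((f (T ω).1, (T ω).2), h (T ω).1)) ((a, b), c) =
      κ a c b * probOf μ (fun ω => (f (T ω).1, h (T ω).1)) (a, c) := by
    intro a b c
    rw [probOf_push μ T (fun d : A × B => ((f d.1, d.2), h d.1)),
      probOf_push μ T (fun d : A × B => (f d.1, h d.1)),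
      Fintype.sum_prod_type, Fintype.sum_prod_type, Finset.mul_sum]
    refine Finset.sum_congr rfl fun a' _ => ?_
    by_cases h1 : f a' = a
    · by_cases h2 : h a' = c
      · simp [hT, h1, h2, ← Finset.mul_sum, hκ, mul_comm]
      · simp [h2]
    · simp [h1]
  unfold condMI condEntropy
  simp only [entropy_eq]
  rw [← expect_sub, ← expect_sub, ← expect_sub, ← expect_add, ← expect_sub, ← expect_sub]
  unfold expect
  refine Finset.sum_congr rfl fun ω _ => ?_
  rcases (hμ ω).eq_or_lt with h0 | h0
  · rw [← h0, zero_mul, zero_mul]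
  have p1 := h0.trans_le (le_probOf hμ (fun ω => (f (T ω).1, h (T ω).1)) ω)
  have p2 := h0.trans_le (le_probOf hμ (fun ω => h (T ω).1) ω)
  have p3 := h0.trans_le (le_probOf hμ (fun ω => ((T ω).2, h (T ω).1)) ω)
  have p4 := h0.trans_le (le_probOf hμ (fun ω => ((f (T ω).1, (T ω).2), h (T ω).1)) ω)
  have p5 : κ (f (T ω).1) (h (T ω).1) (T ω).2 ≠ 0 := by
    intro h5
    have := fac (f (T ω).1) (T ω).2 (h (T ω).1)
    rw [h5, zero_mul] at this
    exact p4.ne' this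
  beta_reduce
  rw [fac, condP, Real.logb_div p3.ne' p2.ne', Real.logb_mul p5 p1.ne']
  ring

lemma probOf_equiv [Fintype C] [Fintype D] (μ : Ω → ℝ) (T : Ω → D) (e : D × C ≃ Ω)
    (he : ∀ d c, T (e (d, c)) = d) (d : D) : probOf μ T d = ∑ c, μ (e (d, c)) := by
  unfold probOf
  rw [← e.sum_comp, Fintype.sum_prod_type]
  simp only [he]
  rw [Finset.sum_eq_single d]
  · simp
  · intro b _ hb
    simp [hb]
  · intro h
    exact absurd (Finset.mem_univ _) h

end Ent

section Code

/-- Building the code and derandomizing the time-sharing sequence. -/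
lemma code_of {𝒳 𝒴 𝒵 Xh Yh Q : Type*} [Fintype 𝒳] [Fintype 𝒴] [Fintype 𝒵] [Fintype Q]
    {p : 𝒳 × 𝒴 × 𝒵 → ℝ} (hp : IsPMF p) {pQ : Q → ℝ} (hpQ : IsPMF pQ)
    {dA : 𝒴 → Yh → ℝ} {dB : 𝒳 → Xh → ℝ} {L DA DB δ θ : ℝ}
    (hdA : ∀ y yv, dA y yv ≤ L) (hdB : ∀ x xv, dB x xv ≤ L) (hL : 0 ≤ L)
    (hDA : 0 ≤ DA) (hDB : 0 ≤ DB) (hδ : 0 < δ) (hθ : L * θ ≤ δ)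
    {n : ℕ} (hn : 0 < n) {M₁ M₂ M₃ M₄ : ℕ}
    (fA : (Fin n → 𝒳 × Q) → Fin M₁) (fB : (Fin n → 𝒴 × Q) → Fin M₂)
    (gA : (Fin n → 𝒵 × Q) → Fin M₁ → Fin M₂ → Fin M₃)
    (gB : (Fin n → 𝒵 × Q) → Fin M₁ → Fin M₂ → Fin M₄)
    (hA : (Fin n → 𝒳 × Q) → Fin M₃ → Fin n → Yh)
    (hB : (Fin n → 𝒴 × Q) → Fin M₄ → Fin n → Xh)
    (hbad : expect (prodW (Fin n) (jn p fun _ => pQ)) (fun w => ind (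
      (n : ℝ) * (DA + δ) ≤ ∑ i, dA (w i).1.2.1 (hA (fun i => ((w i).1.1, (w i).2))
        (gA (fun i => ((w i).1.2.2, (w i).2)) (fA fun i => ((w i).1.1, (w i).2))
          (fB fun i => ((w i).1.2.1, (w i).2))) i) ∨
      (n : ℝ) * (DB + δ) ≤ ∑ i, dB (w i).1.1 (hB (fun i => ((w i).1.2.1, (w i).2))
        (gB (fun i => ((w i).1.2.2, (w i).2)) (fA fun i => ((w i).1.1, (w i).2))
          (fB fun i => ((w i).1.2.1, (w i).2))) i))) ≤ θ) :
    ∃ C : DSCCode 𝒳 𝒴 𝒵 Xh Yh n, Fintype.card C.MAR.carrier = M₁ ∧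
      Fintype.card C.MBR.carrier = M₂ ∧ Fintype.card C.MRA.carrier = M₃ ∧
      Fintype.card C.MRB.carrier = M₄ ∧
      C.distA p dA ≤ DA + 2 * δ ∧ C.distB p dB ≤ DB + 2 * δ := by
  have hk := expect_prodW_kernel (I := Fin n) p (fun _ => pQ) (fun w q => ind (
      (n : ℝ) * (DA + δ) ≤ ∑ i, dA (w i).2.1 (hA (fun i => ((w i).1, q i))
        (gA (fun i => ((w i).2.2, q i)) (fA fun i => ((w i).1, q i))
          (fB fun i => ((w i).2.1, q i))) i) ∨
      (n : ℝ) * (DB + δ) ≤ ∑ i, dB (w i).1 (hB (fun i => ((w i).2.1, q i))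
        (gB (fun i => ((w i).2.2, q i)) (fA fun i => ((w i).1, q i))
          (fB fun i => ((w i).2.1, q i))) i)))
  have hk2 := hk.trans_le hbad
  rw [expect_comm] at hk2
  obtain ⟨q, hq⟩ := exists_le_expect (prodW_isPMF hpQ) hk2
  have hn' : (0 : ℝ) < n := by exact_mod_cast hn
  have hP : IsPMF (prodW (Fin n) p) := prodW_isPMF hp
  -- generic distortion estimate
  have key : ∀ (D : ℝ) (_ : 0 ≤ D) (g : Fin n → (Fin n → 𝒳 × 𝒴 × 𝒵) → ℝ) (_ : ∀ i w, g i w ≤ L)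
      (bad : (Fin n → 𝒳 × 𝒴 × 𝒵) → Prop)
      (_ : ∀ w, (n : ℝ) * (D + δ) ≤ ∑ i, g i w → bad w)
      (_ : expect (prodW (Fin n) p) (fun w => ind (bad w)) ≤ θ),
      (1 / n : ℝ) * ∑ i, expect (prodW (Fin n) p) (g i) ≤ D + 2 * δ := by
    intro D hD g hg bad hb hbθ
    have h1 : ∀ w, ∑ i, g i w ≤ n * (D + δ) + n * L * ind (bad w) := by
      intro w
      by_cases hc : (n : ℝ) * (D + δ) ≤ ∑ i, g i w
      · rw [ind_true (hb w hc)]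
        have : ∑ i, g i w ≤ ∑ _i : Fin n, L := Finset.sum_le_sum fun i _ => hg i w
        simp only [Finset.sum_const, Finset.card_univ, Fintype.card_fin, nsmul_eq_mul] at this
        have : 0 ≤ (n : ℝ) * (D + δ) := by positivity
        linarith
      · have : 0 ≤ n * L * ind (bad w) := mul_nonneg (by positivity) (ind_nonneg _)
        push Not at hc
        linarith
    have h2 := expect_mono hP h1
    rw [expect_add, expect_const hP, expect_const_mul, expect_sum] at h2
    have h3 : L * expect (prodW (Fin n) p) (fun w => ind (bad w)) ≤ δ :=
      (mul_le_mul_of_nonneg_left hbθ hL).trans hθ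
    rw [one_div, inv_mul_le_iff₀ hn']
    nlinarith
  refine ⟨{ MAR := ⟨Fin M₁⟩, MBR := ⟨Fin M₂⟩, MRA := ⟨Fin M₃⟩, MRB := ⟨Fin M₄⟩,
            φAR := fun x => fA fun i => (x i, q i), φBR := fun y => fB fun i => (y i, q i),
            φRA := fun z j₁ j₂ => gA (fun i => (z i, q i)) j₁ j₂,
            φRB := fun z j₁ j₂ => gB (fun i => (z i, q i)) j₁ j₂,
            ΨA := fun x j => hA (fun i => (x i, q i)) j,
            ΨB := fun y j => hB (fun i => (y i, q i)) j },
    Fintype.card_fin _, Fintype.card_fin _, Fintype.card_fin _, Fintype.card_fin _, ?_, ?_⟩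
  · exact key DA hDA _ (fun i w => hdA _ _) _ (fun w hw => Or.inl hw) hq
  · exact key DB hDB _ (fun i w => hdB _ _) _ (fun w hw => Or.inr hw) hq

end Code

/-- **Theorem 2 (inner bound for DSC/delivery).**
If the joint pmf of `(X,Y,Z,Q,U₁,U₂,V₁,V₂)` factorizes as
`p(x,y,z) p(q) p(u₁|x,q) p(u₂|y,q) p(v₁,v₂|u₁,u₂,z,q)` and there are decoders
`Ψ_A(X,V₂)`, `Ψ_B(Y,V₁)` meeting the distortion constraints `D_A`, `D_B`, then every rate
vector with `R_AR ≥ I(X;U₁|Z,U₂,Q)`, `R_BR ≥ I(Y;U₂|Z,U₁,Q)`,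
`R_AR + R_BR ≥ I(X,Y;U₁,U₂|Z,Q)`, `R_RA ≥ I(U₂,Z;V₂|X,U₁,Q)`,
`R_RB ≥ I(U₁,Z;V₁|Y,U₂,Q)` is achievable for DSC/delivery.
Here the sample space is `(𝒳 × 𝒴 × 𝒵) × Q × U₁ × U₂ × V₁ × V₂` with joint pmf `μ`. -/
theorem dsc_delivery_inner_bound
    {𝒳 𝒴 𝒵 Xh Yh : Type*} [Fintype 𝒳] [Fintype 𝒴] [Fintype 𝒵] [Fintype Xh] [Fintype Yh]
    (p : 𝒳 × 𝒴 × 𝒵 → ℝ) (hp : IsPMF p)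
    (dA : 𝒴 → Yh → ℝ) (dB : 𝒳 → Xh → ℝ)
    (hdA : ∀ y yv, 0 ≤ dA y yv) (hdB : ∀ x xv, 0 ≤ dB x xv)
    (RAR RBR RRA RRB DA DB : ℝ)
    (Q U₁ U₂ V₁ V₂ : Type*) [Fintype Q] [Fintype U₁] [Fintype U₂] [Fintype V₁] [Fintype V₂]
    (pQ : Q → ℝ) (hpQ : (∀ q, 0 ≤ pQ q) ∧ ∑ q, pQ q = 1)
    (pU₁ : 𝒳 → Q → U₁ → ℝ) (hpU₁ : ∀ x q, (∀ u, 0 ≤ pU₁ x q u) ∧ ∑ u, pU₁ x q u = 1)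
    (pU₂ : 𝒴 → Q → U₂ → ℝ) (hpU₂ : ∀ y q, (∀ u, 0 ≤ pU₂ y q u) ∧ ∑ u, pU₂ y q u = 1)
    (pV : U₁ → U₂ → 𝒵 → Q → V₁ × V₂ → ℝ)
    (hpV : ∀ u₁ u₂ z q, (∀ v, 0 ≤ pV u₁ u₂ z q v) ∧ ∑ v, pV u₁ u₂ z q v = 1)
    (μ : (𝒳 × 𝒴 × 𝒵) × Q × U₁ × U₂ × V₁ × V₂ → ℝ)
    -- the joint pmf factorizes as p(x,y,z) p(q) p(u₁|x,q) p(u₂|y,q) p(v₁,v₂|u₁,u₂,z,q)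
    (hμ : ∀ ω, μ ω = p ω.1 * pQ ω.2.1 * pU₁ ω.1.1 ω.2.1 ω.2.2.1 *
      pU₂ ω.1.2.1 ω.2.1 ω.2.2.2.1 *
      pV ω.2.2.1 ω.2.2.2.1 ω.1.2.2 ω.2.1 (ω.2.2.2.2.1, ω.2.2.2.2.2))
    (ΨA : 𝒳 → V₂ → Yh) (ΨB : 𝒴 → V₁ → Xh)
    (hDA : expect μ (fun ω => dA ω.1.2.1 (ΨA ω.1.1 ω.2.2.2.2.2)) ≤ DA)
    (hDB : expect μ (fun ω => dB ω.1.1 (ΨB ω.1.2.1 ω.2.2.2.2.1)) ≤ DB)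
    -- R_AR ≥ I(X;U₁|Z,U₂,Q)
    (hRAR : condMI μ (fun ω => ω.1.1) (fun ω => ω.2.2.1)
      (fun ω => (ω.1.2.2, ω.2.2.2.1, ω.2.1)) ≤ RAR)
    -- R_BR ≥ I(Y;U₂|Z,U₁,Q)
    (hRBR : condMI μ (fun ω => ω.1.2.1) (fun ω => ω.2.2.2.1)
      (fun ω => (ω.1.2.2, ω.2.2.1, ω.2.1)) ≤ RBR)
    -- R_AR + R_BR ≥ I(X,Y;U₁,U₂|Z,Q)
    (hsum : condMI μ (fun ω => (ω.1.1, ω.1.2.1)) (fun ω => (ω.2.2.1, ω.2.2.2.1))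
      (fun ω => (ω.1.2.2, ω.2.1)) ≤ RAR + RBR)
    -- R_RA ≥ I(U₂,Z;V₂|X,U₁,Q)
    (hRRA : condMI μ (fun ω => (ω.2.2.2.1, ω.1.2.2)) (fun ω => ω.2.2.2.2.2)
      (fun ω => (ω.1.1, ω.2.2.1, ω.2.1)) ≤ RRA)
    -- R_RB ≥ I(U₁,Z;V₁|Y,U₂,Q)
    (hRRB : condMI μ (fun ω => (ω.2.2.1, ω.1.2.2)) (fun ω => ω.2.2.2.2.1)
      (fun ω => (ω.1.2.1, ω.2.2.2.1, ω.2.1)) ≤ RRB) :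
    DSCAchievable p dA dB RAR RBR RRA RRB DA DB := by
  intro ε hε
  -- nonemptiness
  obtain ⟨⟨x0, y0, z0⟩⟩ := hp.nonempty
  obtain ⟨q0⟩ : Nonempty Q := IsPMF.nonempty hpQ
  obtain ⟨u10⟩ : Nonempty U₁ := IsPMF.nonempty (hpU₁ x0 q0)
  obtain ⟨u20⟩ : Nonempty U₂ := IsPMF.nonempty (hpU₂ y0 q0)
  obtain ⟨⟨v10, v20⟩⟩ : Nonempty (V₁ × V₂) := IsPMF.nonempty (hpV u10 u20 z0 q0)
  have : Nonempty U₁ := ⟨u10⟩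
  have : Nonempty U₂ := ⟨u20⟩
  have : Nonempty V₁ := ⟨v10⟩
  have : Nonempty V₂ := ⟨v20⟩
  -- kernels
  set π : (𝒳 × 𝒴 × 𝒵) × Q → ℝ := jn p fun _ => pQ with hπdef
  have hπ : IsPMF π := jn_isPMF hp fun _ => hpQ
  set x' : (𝒳 × 𝒴 × 𝒵) × Q → 𝒳 × Q := fun a => (a.1.1, a.2) with hx'
  set y' : (𝒳 × 𝒴 × 𝒵) × Q → 𝒴 × Q := fun a => (a.1.2.1, a.2) with hy'
  set z' : (𝒳 × 𝒴 × 𝒵) × Q → 𝒵 × Q := fun a => (a.1.2.2, a.2) with hz'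
  set W₁ : 𝒳 × Q → U₁ → ℝ := fun x => pU₁ x.1 x.2 with hW₁def
  set W₂ : 𝒴 × Q → U₂ → ℝ := fun y => pU₂ y.1 y.2 with hW₂def
  have hW₁ : ∀ x, IsPMF (W₁ x) := fun x => hpU₁ _ _
  have hW₂ : ∀ x, IsPMF (W₂ x) := fun x => hpU₂ _ _
  set KA : U₁ × U₂ × (𝒵 × Q) → V₂ → ℝ := fun s v => ∑ v₁, pV s.1 s.2.1 s.2.2.1 s.2.2.2 (v₁, v)
    with hKAdef
  set KB : U₁ × U₂ × (𝒵 × Q) → V₁ → ℝ := fun s v => ∑ v₂, pV s.1 s.2.1 s.2.2.1 s.2.2.2 (v, v₂)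
    with hKBdef
  have hKA : ∀ s, IsPMF (KA s) := fun s =>
    ⟨fun v => Finset.sum_nonneg fun _ _ => (hpV _ _ _ _).1 _, by
      rw [← (hpV s.1 s.2.1 s.2.2.1 s.2.2.2).2, Fintype.sum_prod_type, Finset.sum_comm]⟩
  have hKB : ∀ s, IsPMF (KB s) := fun s =>
    ⟨fun v => Finset.sum_nonneg fun _ _ => (hpV _ _ _ _).1 _, by
      rw [← (hpV s.1 s.2.1 s.2.2.1 s.2.2.2).2, Fintype.sum_prod_type]⟩
  set ν : (((𝒳 × 𝒴 × 𝒵) × Q) × U₁) × U₂ → ℝ := jn (jn π fun a => W₁ (x' a)) fun p => W₂ (y' p.1)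
    with hνdef
  have hν : IsPMF ν := jn_isPMF (jn_isPMF hπ fun a => hW₁ _) fun a => hW₂ _
  have hμ0 : ∀ ω, 0 ≤ μ ω := fun ω => by
    rw [hμ]
    exact mul_nonneg (mul_nonneg (mul_nonneg (mul_nonneg (hp.1 _) (hpQ.1 _)) ((hpU₁ _ _).1 _))
      ((hpU₂ _ _).1 _)) ((hpV _ _ _ _).1 _)
  set sA : ((((𝒳 × 𝒴 × 𝒵) × Q) × U₁) × U₂) → U₁ × U₂ × (𝒵 × Q) :=
    fun a => (a.1.2, a.2, z' a.1.1) with hsA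
  -- pushforwards
  have hT1 : ∀ d, probOf μ (fun ω => (((ω.1, ω.2.1), ω.2.2.2.1), ω.2.2.1)) d =
      (π d.1.1 * pU₂ d.1.1.1.2.1 d.1.1.2 d.1.2) * pU₁ d.1.1.1.1 d.1.1.2 d.2 := by
    intro d
    rw [probOf_equiv (C := V₁ × V₂) μ _
      ⟨fun d => (d.1.1.1.1, d.1.1.1.2, d.1.2, d.1.1.2, d.2.1, d.2.2),
        fun ω => ((((ω.1, ω.2.1), ω.2.2.2.1), ω.2.2.1), (ω.2.2.2.2.1, ω.2.2.2.2.2)),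
        fun _ => rfl, fun _ => rfl⟩ (fun _ _ => rfl)]
    simp only [hμ, Equiv.coe_fn_mk, ← Finset.mul_sum, Prod.mk.eta, (hpV _ _ _ _).2]
    simp only [hπdef, jn]
    ring
  have hT3 : ∀ d, probOf μ (fun ω => ((ω.1, ω.2.1), (ω.2.2.1, ω.2.2.2.1))) d =
      π d.1 * (pU₁ d.1.1.1 d.1.2 d.2.1 * pU₂ d.1.1.2.1 d.1.2 d.2.2) := by
    intro d
    rw [probOf_equiv (C := V₁ × V₂) μ _
      ⟨fun d => (d.1.1.1, d.1.1.2, d.1.2.1, d.1.2.2, d.2.1, d.2.2),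
        fun ω => (((ω.1, ω.2.1), (ω.2.2.1, ω.2.2.2.1)), (ω.2.2.2.2.1, ω.2.2.2.2.2)),
        fun _ => rfl, fun _ => rfl⟩ (fun _ _ => rfl)]
    simp only [hμ, Equiv.coe_fn_mk, ← Finset.mul_sum, Prod.mk.eta, (hpV _ _ _ _).2]
    simp only [hπdef, jn]
    ring
  have hT2 : probOf μ (fun ω => (((ω.1, ω.2.1), ω.2.2.1), ω.2.2.2.1)) = ν := by
    funext d
    rw [probOf_equiv (C := V₁ × V₂) μ _
      ⟨fun d => (d.1.1.1.1, d.1.1.1.2, d.1.1.2, d.1.2, d.2.1, d.2.2),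
        fun ω => ((((ω.1, ω.2.1), ω.2.2.1), ω.2.2.2.1), (ω.2.2.2.2.1, ω.2.2.2.2.2)),
        fun _ => rfl, fun _ => rfl⟩ (fun _ _ => rfl)]
    simp only [hμ, Equiv.coe_fn_mk, ← Finset.mul_sum, Prod.mk.eta, (hpV _ _ _ _).2]
    simp only [hνdef, hπdef, jn, hW₁def, hW₂def, hx', hy', mul_one]
  have hTA : probOf μ (fun ω => ((((ω.1, ω.2.1), ω.2.2.1), ω.2.2.2.1), ω.2.2.2.2.2)) =
      jn ν fun a => KA (sA a) := by
    funext d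
    rw [probOf_equiv (C := V₁) μ _
      ⟨fun d => (d.1.1.1.1.1, d.1.1.1.1.2, d.1.1.1.2, d.1.1.2, d.2, d.1.2),
        fun ω => (((((ω.1, ω.2.1), ω.2.2.1), ω.2.2.2.1), ω.2.2.2.2.2), ω.2.2.2.2.1),
        fun _ => rfl, fun _ => rfl⟩ (fun _ _ => rfl)]
    simp only [hμ, Equiv.coe_fn_mk, ← Finset.mul_sum]
    simp only [hνdef, hπdef, jn, hW₁def, hW₂def, hx', hy', hKAdef, hsA, hz']
  have hTB : probOf μ (fun ω => ((((ω.1, ω.2.1), ω.2.2.1), ω.2.2.2.1), ω.2.2.2.2.1)) =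
      jn ν fun a => KB (sA a) := by
    funext d
    rw [probOf_equiv (C := V₂) μ _
      ⟨fun d => (d.1.1.1.1.1, d.1.1.1.1.2, d.1.1.1.2, d.1.1.2, d.1.2, d.2),
        fun ω => (((((ω.1, ω.2.1), ω.2.2.1), ω.2.2.2.1), ω.2.2.2.2.1), ω.2.2.2.2.2),
        fun _ => rfl, fun _ => rfl⟩ (fun _ _ => rfl)]
    simp only [hμ, Equiv.coe_fn_mk, ← Finset.mul_sum]
    simp only [hνdef, hπdef, jn, hW₁def, hW₂def, hx', hy', hKBdef, hsA, hz']
  -- information identities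
  have i1 := condMI_eq hμ0 (fun ω => (((ω.1, ω.2.1), ω.2.2.2.1), ω.2.2.1))
    (fun a => π a.1 * pU₂ a.1.1.2.1 a.1.2 a.2)
    (fun (x : 𝒳) (c : 𝒵 × U₂ × Q) (u : U₁) => pU₁ x c.2.2 u)
    (fun a => a.1.1.1) (fun a => (a.1.1.2.2, a.2, a.1.2)) hT1 (fun a c => (hpU₁ _ _).2)
  have i2 := condMI_eq hμ0 (fun ω => (((ω.1, ω.2.1), ω.2.2.1), ω.2.2.2.1))
    (jn π fun a => W₁ (x' a))
    (fun (y : 𝒴) (c : 𝒵 × U₁ × Q) (u : U₂) => pU₂ y c.2.2 u)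
    (fun a => a.1.1.2.1) (fun a => (a.1.1.2.2, a.2, a.1.2)) (fun d => congrFun hT2 d)
    (fun a c => (hpU₂ _ _).2)
  have i3 := condMI_eq hμ0 (fun ω => ((ω.1, ω.2.1), (ω.2.2.1, ω.2.2.2.1))) π
    (fun (xy : 𝒳 × 𝒴) (c : 𝒵 × Q) (u : U₁ × U₂) => pU₁ xy.1 c.2 u.1 * pU₂ xy.2 c.2 u.2)
    (fun a => (a.1.1, a.1.2.1)) (fun a => (a.1.2.2, a.2)) hT3
    (fun a c => by
      rw [Fintype.sum_prod_type]
      simp only [← Finset.mul_sum, (hpU₂ _ _).2, mul_one, (hpU₁ _ _).2])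
  have iA := condMI_eq hμ0
    (fun ω => ((((ω.1, ω.2.1), ω.2.2.1), ω.2.2.2.1), ω.2.2.2.2.2)) ν
    (fun (uz : U₂ × 𝒵) (c : 𝒳 × U₁ × Q) (v : V₂) => KA (c.2.1, uz.1, (uz.2, c.2.2)) v)
    (fun a => (a.2, a.1.1.1.2.2)) (fun a => (a.1.1.1.1, a.1.2, a.1.1.2))
    (fun d => congrFun hTA d) (fun a c => (hKA _).2)
  have iB := condMI_eq hμ0
    (fun ω => ((((ω.1, ω.2.1), ω.2.2.1), ω.2.2.2.1), ω.2.2.2.2.1)) ν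
    (fun (uz : U₁ × 𝒵) (c : 𝒴 × U₂ × Q) (v : V₁) => KB (uz.1, c.2.1, (uz.2, c.2.2)) v)
    (fun a => (a.1.2, a.1.1.1.2.2)) (fun a => (a.1.1.1.2.1, a.2, a.1.1.2))
    (fun d => congrFun hTB d) (fun a c => (hKB _).2)
  replace hRAR := i1.symm.trans_le hRAR
  replace hRBR := i2.symm.trans_le hRBR
  replace hsum := i3.symm.trans_le hsum
  replace hRRA := iA.symm.trans_le hRRA
  replace hRRB := iB.symm.trans_le hRRB
  clear i1 i2 i3 iA iB
  have c2 : ∀ F : ((((𝒳 × 𝒴 × 𝒵) × Q) × U₁) × U₂) → ℝ, expect ν F =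
      expect μ (fun ω => F (((ω.1, ω.2.1), ω.2.2.1), ω.2.2.2.1)) := fun F => by
    rw [← hT2]
    exact (expect_comp μ (fun ω => (((ω.1, ω.2.1), ω.2.2.1), ω.2.2.2.1)) F).symm
  have cA : ∀ F : (((((𝒳 × 𝒴 × 𝒵) × Q) × U₁) × U₂) × V₂) → ℝ,
      expect (jn ν fun a => KA (sA a)) F =
      expect μ (fun ω => F ((((ω.1, ω.2.1), ω.2.2.1), ω.2.2.2.1), ω.2.2.2.2.2)) := fun F => by
    rw [← hTA]
    exact (expect_comp μ
      (fun ω => ((((ω.1, ω.2.1), ω.2.2.1), ω.2.2.2.1), ω.2.2.2.2.2)) F).symm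
  have cB : ∀ F : (((((𝒳 × 𝒴 × 𝒵) × Q) × U₁) × U₂) × V₁) → ℝ,
      expect (jn ν fun a => KB (sA a)) F =
      expect μ (fun ω => F ((((ω.1, ω.2.1), ω.2.2.1), ω.2.2.2.1), ω.2.2.2.2.1)) := fun F => by
    rw [← hTB]
    exact (expect_comp μ
      (fun ω => ((((ω.1, ω.2.1), ω.2.2.1), ω.2.2.2.1), ω.2.2.2.2.1)) F).symm
  -- positivity
  have pos2 : ∀ d, 0 < ν d → ∃ ω, (((ω.1, ω.2.1), ω.2.2.1), ω.2.2.2.1) = d ∧ 0 < μ ω :=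
    fun d hd => exists_of_probOf_pos _ (by rw [hT2]; exact hd)
  -- constants
  obtain ⟨L, hL, hLA, hLB⟩ : ∃ L : ℝ, 0 < L ∧ (∀ y yv, dA y yv ≤ L) ∧ (∀ x xv, dB x xv ≤ L) := by
    refine ⟨1 + (∑ a : 𝒴 × Yh, dA a.1 a.2) + ∑ a : 𝒳 × Xh, dB a.1 a.2, ?_, ?_, ?_⟩
    · have := Finset.sum_nonneg fun (a : 𝒴 × Yh) (_ : a ∈ Finset.univ) => hdA a.1 a.2
      have := Finset.sum_nonneg fun (a : 𝒳 × Xh) (_ : a ∈ Finset.univ) => hdB a.1 a.2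
      linarith
    · intro y yv
      have h1 := Finset.single_le_sum (f := fun a : 𝒴 × Yh => dA a.1 a.2)
        (fun a _ => hdA a.1 a.2) (Finset.mem_univ (y, yv))
      have := Finset.sum_nonneg fun (a : 𝒳 × Xh) (_ : a ∈ Finset.univ) => hdB a.1 a.2
      dsimp only at h1
      linarith
    · intro y yv
      have h1 := Finset.single_le_sum (f := fun a : 𝒳 × Xh => dB a.1 a.2)
        (fun a _ => hdB a.1 a.2) (Finset.mem_univ (y, yv))
      have := Finset.sum_nonneg fun (a : 𝒴 × Yh) (_ : a ∈ Finset.univ) => hdA a.1 a.2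
      dsimp only at h1
      linarith
  set δ := ε / 2 with hδdef
  have hδ : 0 < δ := by positivity
  set η := δ / (5 * L) with hηdef
  have hη : 0 < η := by positivity
  have hDA0 : 0 ≤ DA :=
    le_trans (Finset.sum_nonneg fun ω _ => mul_nonneg (hμ0 ω) (hdA _ _)) hDA
  have hDB0 : 0 ≤ DB :=
    le_trans (Finset.sum_nonneg fun ω _ => mul_nonneg (hμ0 ω) (hdB _ _)) hDB
  -- asymptotic ingredients
  have EA := asymp_WZ hν sA (fun a => (x' a.1.1, a.1.2)) hKA
    (r := fun (t : (𝒳 × Q) × U₁) v => condP μ (fun ω => ω.2.2.2.2.2)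
      (fun ω => (ω.1.1, ω.2.2.1, ω.2.1)) (t.1.1, t.2, t.1.2) v)
    (fun _ _ => condP_nonneg hμ0 _ _ _ _) (fun _ => condP_sum _ _ _ _)
    (fun a v h1 h2 => by
      have h3 : 0 < (jn ν fun a => KA (sA a)) (a, v) := mul_pos h1 h2
      rw [← hTA] at h3
      obtain ⟨ω, hω, hω0⟩ := exists_of_probOf_pos _ h3
      have h4 := condP_pos hμ0 (fun ω => ω.2.2.2.2.2) (fun ω => (ω.1.1, ω.2.2.1, ω.2.1)) hω0
      rw [Prod.ext_iff] at hω
      obtain ⟨rfl, rfl⟩ := hω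
      exact h4) hε hη (R := RRA) (by rw [cA, cA]; exact hRRA)
  have EB := asymp_WZ hν sA (fun a => (y' a.1.1, a.2)) hKB
    (r := fun (t : (𝒴 × Q) × U₂) v => condP μ (fun ω => ω.2.2.2.2.1)
      (fun ω => (ω.1.2.1, ω.2.2.2.1, ω.2.1)) (t.1.1, t.2, t.1.2) v)
    (fun _ _ => condP_nonneg hμ0 _ _ _ _) (fun _ => condP_sum _ _ _ _)
    (fun a v h1 h2 => by
      have h3 : 0 < (jn ν fun a => KB (sA a)) (a, v) := mul_pos h1 h2
      rw [← hTB] at h3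
      obtain ⟨ω, hω, hω0⟩ := exists_of_probOf_pos _ h3
      have h4 := condP_pos hμ0 (fun ω => ω.2.2.2.2.1)
        (fun ω => (ω.1.2.1, ω.2.2.2.1, ω.2.1)) hω0
      rw [Prod.ext_iff] at hω
      obtain ⟨rfl, rfl⟩ := hω
      exact h4) hε hη (R := RRB) (by rw [cB, cB]; exact hRRB)
  have EBT := asymp_BT hπ x' y' z' hW₁ hW₂
    (r₁ := fun z v u => condP μ (fun ω => ω.2.2.1)
      (fun ω => (ω.1.2.2, ω.2.2.2.1, ω.2.1)) (z.1, v, z.2) u)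
    (r₂ := fun z u v => condP μ (fun ω => ω.2.2.2.1)
      (fun ω => (ω.1.2.2, ω.2.2.1, ω.2.1)) (z.1, u, z.2) v)
    (r₃ := fun z uv => condP μ (fun ω => (ω.2.2.1, ω.2.2.2.1))
      (fun ω => (ω.1.2.2, ω.2.1)) (z.1, z.2) uv)
    (fun _ _ _ => condP_nonneg hμ0 _ _ _ _) (fun _ _ => condP_sum _ _ _ _)
    (fun _ _ _ => condP_nonneg hμ0 _ _ _ _) (fun _ _ => condP_sum _ _ _ _)
    (fun _ _ => condP_nonneg hμ0 _ _ _ _) (fun _ => condP_sum _ _ _ _)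
    (ν := ν) hνdef
    (fun d hd => by
      obtain ⟨ω, rfl, hω0⟩ := pos2 d hd
      exact condP_pos hμ0 (fun ω => ω.2.2.1) (fun ω => (ω.1.2.2, ω.2.2.2.1, ω.2.1)) hω0)
    (fun d hd => by
      obtain ⟨ω, rfl, hω0⟩ := pos2 d hd
      exact condP_pos hμ0 (fun ω => ω.2.2.2.1) (fun ω => (ω.1.2.2, ω.2.2.1, ω.2.1)) hω0)
    (fun d hd => by
      obtain ⟨ω, rfl, hω0⟩ := pos2 d hd
      exact condP_pos hμ0 (fun ω => (ω.2.2.1, ω.2.2.2.1)) (fun ω => (ω.1.2.2, ω.2.1)) hω0)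
    (R₁ := RAR) (R₂ := RBR) hε hη
    (by rw [c2, c2]; exact hRAR) (by rw [c2, c2]; exact hRBR)
    (by
      rw [c2, c2, c2, sub_sub, ← expect_add]
      refine le_trans (le_of_eq ?_) hsum
      congr 1
      refine Finset.sum_congr rfl fun ω _ => ?_
      rcases (hμ0 ω).eq_or_lt with h0 | h0
      · rw [← h0, zero_mul, zero_mul]
      have hne : ∀ ω, μ ω ≠ 0 → pU₁ ω.1.1 ω.2.1 ω.2.2.1 ≠ 0 ∧
          pU₂ ω.1.2.1 ω.2.1 ω.2.2.2.1 ≠ 0 := by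
        intro ω h
        rw [hμ] at h
        exact ⟨fun h1 => h (by rw [h1]; ring), fun h1 => h (by rw [h1]; ring)⟩
      obtain ⟨n1, n2⟩ := hne ω h0.ne'
      simp only [hW₁def, hW₂def, hx', hy']
      rw [Real.logb_mul n1 n2]
      ring)
  have LA := wlln (jn_isPMF hν fun a => hKA (sA a))
    (fun a => dA a.1.1.1.1.2.1 (ΨA a.1.1.1.1.1 a.2)) hδ hη
  have LB := wlln (jn_isPMF hν fun a => hKB (sA a))
    (fun a => dB a.1.1.1.1.1 (ΨB a.1.1.1.1.2.1 a.2)) hδ hη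
  rw [cA] at LA
  rw [cB] at LB
  obtain ⟨N, hN⟩ := Filter.eventually_atTop.1
    ((((EA.and EB).and EBT).and (LA.and LB)).and (Filter.eventually_gt_atTop 0))
  refine ⟨N, fun n hn => ?_⟩
  obtain ⟨⟨⟨⟨⟨M₃, hM₃, wzA⟩, ⟨M₄, hM₄, wzB⟩⟩, ⟨M₁, M₂, hM₁, hM₂, bt⟩⟩, la, lb⟩, hn0⟩ := hN n hn
  clear hN EA EB EBT LA LB
  have hn' : (0 : ℝ) ≤ n := Nat.cast_nonneg n
  obtain ⟨kA, eA, decA, hA⟩ := wzA (fun w v => ind ((n : ℝ) * (DA + δ) ≤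
    ∑ i, dA (w i).1.1.1.2.1 (ΨA (w i).1.1.1.1 (v i)))) (fun _ _ => ind_nonneg _)
    (fun _ _ => ind_le_one _)
  obtain ⟨kB, eB, decB, hB⟩ := wzB (fun w v => ind ((n : ℝ) * (DB + δ) ≤
    ∑ i, dB (w i).1.1.1.1 (ΨB (w i).1.1.1.2.1 (v i)))) (fun _ _ => ind_nonneg _)
    (fun _ _ => ind_le_one _)
  have hA2 := hA.trans (add_le_add ((expect_mono
    (prodW_isPMF (jn_isPMF hν fun a => hKA (sA a))) fun w => ind_mono fun h =>
      (mul_le_mul_of_nonneg_left (add_le_add hDA le_rfl) hn').trans h).trans la) le_rfl)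
  have hB2 := hB.trans (add_le_add ((expect_mono
    (prodW_isPMF (jn_isPMF hν fun a => hKB (sA a))) fun w => ind_mono fun h =>
      (mul_le_mul_of_nonneg_left (add_le_add hDB le_rfl) hn').trans h).trans lb) le_rfl)
  obtain ⟨m₁, m₂, e₁, e₂, D, hbt⟩ := bt (fun w u₁ u₂ => ind (
    (n : ℝ) * (DA + δ) ≤ ∑ i, dA (w i).1.2.1 (ΨA (w i).1.1
      (decA (fun i => (x' (w i), u₁ i)) (kA (eA fun i => (u₁ i, u₂ i, z' (w i)))) i)) ∨
    (n : ℝ) * (DB + δ) ≤ ∑ i, dB (w i).1.1 (ΨB (w i).1.2.1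
      (decB (fun i => (y' (w i), u₂ i)) (kB (eB fun i => (u₁ i, u₂ i, z' (w i)))) i))))
    (fun _ _ _ => ind_nonneg _) (fun _ _ _ => ind_le_one _)
  obtain ⟨C, k1, k2, k3, k4, hCA, hCB⟩ := code_of hp hpQ (DA := DA) (DB := DB) (δ := δ)
    (θ := 5 * η) hLA hLB hL.le hDA0 hDB0 hδ
    (by rw [hηdef]; field_simp; exact le_rfl) hn0
    (fun x => m₁ (e₁ x)) (fun y => m₂ (e₂ y))
    (fun z j₁ j₂ => kA (eA fun i => ((D z j₁ j₂).1 i, (D z j₁ j₂).2 i, z i)))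
    (fun z j₁ j₂ => kB (eB fun i => ((D z j₁ j₂).1 i, (D z j₁ j₂).2 i, z i)))
    (fun x j i => ΨA (x i).1 (decA (fun i => (x i, e₁ x i)) j i))
    (fun y j i => ΨB (y i).1 (decB (fun i => (y i, e₂ y i)) j i))
    (by
      refine le_trans (expect_mono (prodW_isPMF hπ) fun w => ?_) (hbt.trans ?_)
      · split_ifs with h
        · refine ind_mono fun hh => ?_
          change D (fun i => ((w i).1.2.2, (w i).2)) (m₁ (e₁ fun i => ((w i).1.1, (w i).2)))
            (m₂ (e₂ fun i => ((w i).1.2.1, (w i).2))) = _ at h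
          rw [h] at hh
          exact hh
        · exact ind_le_one _
      · have h5 := (expect_mono (prodW_isPMF hν) fun w => ind_or_le
          ((n : ℝ) * (DA + δ) ≤ ∑ i, dA (w i).1.1.1.2.1 (ΨA (w i).1.1.1.1
            (decA (fun i => (x' (w i).1.1, (w i).1.2)) (kA (eA fun i => sA (w i))) i)))
          ((n : ℝ) * (DB + δ) ≤ ∑ i, dB (w i).1.1.1.1 (ΨB (w i).1.1.1.2.1
            (decB (fun i => (y' (w i).1.1, (w i).2)) (kB (eB fun i => sA (w i))) i)))).trans
          ((expect_add _ _ _).trans_le (add_le_add hA2 hB2))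
        refine le_trans (add_le_add h5 le_rfl) ?_
        linarith)
  have h2δ : 2 * δ = ε := by rw [hδdef]; ring
  rw [h2δ] at hCA hCB
  refine ⟨C, ?_, ?_, ?_, ?_, hCA, hCB⟩
  · rw [k1]; exact hM₁
  · rw [k2]; exact hM₂
  · rw [k3]; exact hM₃
  · rw [k4]; exact hM₄

end IRSC
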